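/- arXiv:math/0103058 — 3 statements merged into one kernel-verified Lean document; each statement's English description precedes it below -/
import Mathlib

section
/- The Riemann Hypothesis holds if and only if χ belongs to the closure in K of the union over 0<λ<1 of the subspaces B_λ. -/
open MeasureTheory Set

namespace NymanBeurling

open Filter Topology Complex FourierTransform
open scoped ENNReal ContDiff

/-! ### Plancherel for the Fourier integral and for the Mellin transform -/

/-- **Plancherel's theorem** for the Fourier integral of a function in `L¹ ∩ L²`. -/
theorem eLpNorm_fourier_eq {f : ℝ → ℂ} (h1 : Integrable f) (h2 : MemLp f 2) :
    eLpNorm (𝓕 f) 2 volume = eLpNorm f 2 volume := by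
  have hcont : Continuous (𝓕 f) :=
    VectorFourier.fourierIntegral_continuous Real.continuous_fourierChar
      (by simpa using! continuous_inner) h1
  have key : ((𝓕 (h2.toLp f) : Lp ℂ 2 (volume : Measure ℝ)) : ℝ → ℂ) =ᵐ[volume] 𝓕 f := by
    refine ae_eq_of_integral_contDiff_smul_eq
      ((Lp.memLp _).locallyIntegrable one_le_two) hcont.locallyIntegrable fun g hg hgs ↦ ?_
    have hgs' : HasCompactSupport (fun x ↦ (g x : ℂ)) :=
      hgs.comp_left (g := fun x : ℝ ↦ (x : ℂ)) (by simp)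
    have hg' : ContDiff ℝ ∞ (fun x ↦ (g x : ℂ)) := ofRealCLM.contDiff.comp hg
    set φ : SchwartzMap ℝ ℂ := hgs'.toSchwartzMap hg' with hφ
    have hφx (x : ℝ) : φ x = (g x : ℂ) := rfl
    have e1 := DFunLike.congr_fun (Lp.fourier_toTemperedDistribution_eq (h2.toLp f)) φ
    rw [TemperedDistribution.fourier_apply, Lp.toTemperedDistribution_apply,
      Lp.toTemperedDistribution_apply] at e1
    have e2 : ∫ x, (𝓕 φ) x • (h2.toLp f : ℝ → ℂ) x = ∫ x, (𝓕 φ) x • f x := by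
      refine integral_congr_ae ?_
      filter_upwards [h2.coeFn_toLp] with x hx
      rw [hx]
    have e3 : ∫ x, (𝓕 φ) x • f x = ∫ x, φ x • (𝓕 f) x := by
      have := VectorFourier.integral_fourierIntegral_smul_eq_flip (L := innerₗ ℝ) (μ := volume)
        (ν := volume) (f := φ) (g := f) Real.continuous_fourierChar
        (by simpa using! continuous_inner) φ.integrable h1
      rw [flip_innerₗ] at this
      rw [SchwartzMap.fourier_coe]
      exact this
    simpa only [hφx, smul_eq_mul, real_smul] using e1.symm.trans (e2.trans e3)
  rw [← eLpNorm_congr_ae key, ← eLpNorm_congr_ae h2.coeFn_toLp]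
  have := Lp.norm_fourier_eq (h2.toLp f)
  rw [Lp.norm_def, Lp.norm_def, ENNReal.toReal_eq_toReal_iff' (Lp.eLpNorm_ne_top _)
    (Lp.eLpNorm_ne_top _)] at this
  exact this

/-- The point `1/2 + 2πit` of the critical line. -/
noncomputable def critLine (t : ℝ) : ℂ := 1 / 2 + 2 * Real.pi * t * I

theorem critLine_re (t : ℝ) : (critLine t).re = 1 / 2 := by
  simp [critLine]

theorem critLine_im (t : ℝ) : (critLine t).im = 2 * Real.pi * t := by
  simp [critLine]

theorem continuous_critLine : Continuous critLine := by
  unfold critLine; fun_prop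

theorem image_exp_neg_univ : image (fun u : ℝ ↦ Real.exp (-u)) univ = Ioi 0 := by
  rw [image_univ, ← Real.range_exp]
  exact (Equiv.neg ℝ).surjective.range_comp Real.exp

theorem hasDerivAt_exp_neg (u : ℝ) :
    HasDerivAt (fun u : ℝ ↦ Real.exp (-u)) (-Real.exp (-u)) u := by
  simpa using (hasDerivAt_neg u).exp

theorem injective_exp_neg : Function.Injective (fun u : ℝ ↦ Real.exp (-u)) :=
  Real.exp_injective.comp neg_injective

/-- **Plancherel's theorem** for the Mellin transform on the critical line. -/
theorem eLpNorm_mellin_critLine {f : ℝ → ℂ} (h1 : MellinConvergent f (1 / 2))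
    (h2 : MemLp f 2 (volume.restrict (Ioi 0))) :
    eLpNorm (fun t ↦ mellin f (critLine t)) 2 volume
      = eLpNorm f 2 (volume.restrict (Ioi 0)) := by
  set h : ℝ → ℂ := fun u ↦ Real.exp (-(1 / 2) * u) • f (Real.exp (-u)) with hh
  have hint : Integrable h := by
    have := (integrableOn_image_iff_integrableOn_abs_deriv_smul MeasurableSet.univ
      (fun u _ ↦ (hasDerivAt_exp_neg u).hasDerivWithinAt) injective_exp_neg.injOn
      (fun t : ℝ ↦ (t : ℂ) ^ ((1 / 2 : ℂ) - 1) • f t)).1 (by rwa [image_exp_neg_univ])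
    rw [integrableOn_univ] at this
    refine this.congr (Eventually.of_forall fun u ↦ ?_)
    simp only [hh, abs_neg, abs_of_pos (Real.exp_pos _), smul_eq_mul, real_smul]
    rw [← mul_assoc]
    congr 1
    rw [ofReal_exp, ofReal_exp, cpow_def_of_ne_zero (exp_ne_zero _), ← ofReal_exp,
      ← ofReal_log (Real.exp_pos _).le, Real.log_exp, ofReal_exp, ← Complex.exp_add]
    push_cast
    ring_nf
  have hnorm : eLpNorm h 2 volume = eLpNorm f 2 (volume.restrict (Ioi 0)) := by
    rw [eLpNorm_eq_lintegral_rpow_enorm_toReal two_ne_zero ENNReal.ofNat_ne_top,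
      eLpNorm_eq_lintegral_rpow_enorm_toReal two_ne_zero ENNReal.ofNat_ne_top]
    congr 1
    rw [← image_exp_neg_univ, lintegral_image_eq_lintegral_abs_deriv_mul MeasurableSet.univ
      (fun u _ ↦ (hasDerivAt_exp_neg u).hasDerivWithinAt) injective_exp_neg.injOn,
      setLIntegral_univ]
    refine lintegral_congr fun u ↦ ?_
    simp only [hh, abs_neg, abs_of_pos (Real.exp_pos _), ENNReal.toReal_ofNat,
      ENNReal.rpow_ofNat, enorm_smul, mul_pow]
    congr 1
    rw [Real.enorm_eq_ofReal (Real.exp_pos _).le, ← ENNReal.ofReal_pow (Real.exp_pos _).le,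
      ← Real.exp_nat_mul]
    congr 2
    push_cast
    ring
  have hL2 : MemLp h 2 := ⟨hint.aestronglyMeasurable, hnorm ▸ h2.2⟩
  rw [← hnorm, ← eLpNorm_fourier_eq hint hL2]
  congr 1
  ext t
  rw [mellin_eq_fourier, critLine_re, critLine_im, mul_div_cancel_left₀ _ (by positivity)]

/-! ### The Mellin transform of the fractional part -/

/-- The function `{1/t}` restricted to `(0, 1]`. -/
noncomputable def fractIoc : ℝ → ℂ :=
  indicator (Ioc 0 1) fun t : ℝ ↦ ((Int.fract (1 / t) : ℝ) : ℂ)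

theorem measurable_fract_div (θ : ℝ) :
    Measurable fun t : ℝ ↦ ((Int.fract (θ / t) : ℝ) : ℂ) :=
  measurable_ofReal.comp (measurable_fract.comp (measurable_const.div measurable_id))

theorem measurable_fractIoc : Measurable fractIoc :=
  (measurable_fract_div 1).indicator measurableSet_Ioc

theorem norm_fract_le (x : ℝ) : ‖((Int.fract x : ℝ) : ℂ)‖ ≤ 1 := by
  rw [norm_real, Real.norm_of_nonneg (Int.fract_nonneg x)]
  exact (Int.fract_lt_one x).le

theorem norm_fractIoc_le (t : ℝ) : ‖fractIoc t‖ ≤ 1 := by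
  unfold fractIoc
  by_cases h : t ∈ Ioc (0 : ℝ) 1
  · rw [indicator_of_mem h]; exact norm_fract_le _
  · rw [indicator_of_notMem h]; simp

theorem locallyIntegrable_fractIoc : LocallyIntegrable fractIoc := by
  refine (locallyIntegrable_const (1 : ℝ)).mono measurable_fractIoc.aestronglyMeasurable ?_
  exact Eventually.of_forall fun t ↦ by simpa using norm_fractIoc_le t

theorem fractIoc_isBigO_atTop (a : ℝ) : fractIoc =O[atTop] fun t : ℝ ↦ t ^ (-a) := by
  refine Asymptotics.IsBigO.congr' (Asymptotics.isBigO_zero _ _) ?_ EventuallyEq.rfl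
  filter_upwards [eventually_gt_atTop 1] with t ht
  rw [fractIoc, indicator_of_notMem fun h ↦ not_le.2 ht h.2]

theorem fractIoc_isBigO_zero : fractIoc =O[𝓝[>] 0] fun t : ℝ ↦ t ^ (-(0 : ℝ)) := by
  refine Asymptotics.IsBigO.of_bound 1 (Eventually.of_forall fun t ↦ ?_)
  simpa using norm_fractIoc_le t

theorem mellinConvergent_fractIoc {s : ℂ} (hs : 0 < s.re) : MellinConvergent fractIoc s :=
  mellinConvergent_of_isBigO_rpow (locallyIntegrable_fractIoc.locallyIntegrableOn _)
    (fractIoc_isBigO_atTop (s.re + 1)) (by linarith) fractIoc_isBigO_zero hs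

theorem differentiableAt_mellin_fractIoc {s : ℂ} (hs : 0 < s.re) :
    DifferentiableAt ℂ (mellin fractIoc) s :=
  mellin_differentiableAt_of_isBigO_rpow (locallyIntegrable_fractIoc.locallyIntegrableOn _)
    (fractIoc_isBigO_atTop (s.re + 1)) (by linarith) fractIoc_isBigO_zero hs

theorem norm_mellin_fractIoc_le {s : ℂ} (hs : 0 < s.re) : ‖mellin fractIoc s‖ ≤ 1 / s.re := by
  have hint : IntegrableOn (fun t : ℝ ↦ t ^ (s.re - 1)) (Ioc 0 1) := by
    have := intervalIntegral.intervalIntegrable_rpow' (a := 0) (b := 1) (r := s.re - 1)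
      (by linarith)
    rwa [intervalIntegrable_iff_integrableOn_Ioc_of_le zero_le_one] at this
  have hval : ∫ t in Ioi (0 : ℝ), indicator (Ioc 0 1) (fun t : ℝ ↦ t ^ (s.re - 1)) t =
      1 / s.re := by
    rw [setIntegral_indicator measurableSet_Ioc,
      inter_eq_right.2 Ioc_subset_Ioi_self,
      ← intervalIntegral.integral_of_le zero_le_one, integral_rpow (Or.inl (by linarith))]
    simp [hs.ne']
  rw [← hval, mellin]
  refine norm_integral_le_of_norm_le ?_ ?_
  · exact (hint.integrable_indicator measurableSet_Ioc).integrableOn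
  · refine (ae_restrict_mem measurableSet_Ioi).mono fun t ht ↦ ?_
    rw [norm_smul, norm_cpow_eq_rpow_re_of_pos ht]
    by_cases h : t ∈ Ioc (0 : ℝ) 1
    · rw [indicator_of_mem h]
      simpa using mul_le_mul_of_nonneg_left (norm_fractIoc_le t)
        (Real.rpow_nonneg (le_of_lt ht) (s.re - 1))
    · simp [fractIoc, indicator_of_notMem h]

theorem mellin_fractIoc_eq_integral {s : ℂ} :
    mellin fractIoc s = ∫ t : ℝ in Ioi 1, ((Int.fract t : ℝ) : ℂ) * (t : ℂ) ^ (-(s + 1)) := by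
  have h := mellin_comp_inv fractIoc (-s)
  rw [neg_neg] at h
  rw [← h, mellin, ← integral_Ici_eq_integral_Ioi (x := (1 : ℝ))]
  have : Ici (1 : ℝ) = Ioi 0 ∩ Ici 1 := by
    rw [eq_comm, inter_eq_right]; exact fun t (ht : 1 ≤ t) ↦ zero_lt_one.trans_le ht
  rw [this, ← setIntegral_indicator measurableSet_Ici]
  refine setIntegral_congr_fun measurableSet_Ioi fun t (ht : 0 < t) ↦ ?_
  by_cases h1 : 1 ≤ t
  · have : t⁻¹ ∈ Ioc (0 : ℝ) 1 := ⟨inv_pos.2 ht, inv_le_one_of_one_le₀ h1⟩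
    simp only [fractIoc, indicator_of_mem this, indicator_of_mem (show t ∈ Ici (1 : ℝ) from h1),
      smul_eq_mul, one_div, inv_inv]
    rw [mul_comm, neg_add']
  · have : t⁻¹ ∉ Ioc (0 : ℝ) 1 := fun h ↦ h1 (by
      have := h.2; rwa [inv_le_one₀ ht] at this)
    simp [fractIoc, indicator_of_notMem this, indicator_of_notMem (show t ∉ Ici (1 : ℝ) from h1)]

theorem riemannZeta_eq_integral {s : ℂ} (hs : 1 < s.re) :
    riemannZeta s = s * ∫ t : ℝ in Ioi 1, (⌊t⌋₊ : ℂ) * (t : ℂ) ^ (-(s + 1)) := by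
  rw [← LSeries_one_eq_riemannZeta hs, LSeries_eq_mul_integral' 1 (r := 1) zero_le_one hs]
  · congr 1
    refine setIntegral_congr_fun measurableSet_Ioi fun t _ ↦ ?_
    simp
  · refine Asymptotics.IsBigO.of_bound 1 (Eventually.of_forall fun n ↦ ?_)
    simp

theorem fract_integrable {s : ℂ} (hs : 0 < s.re) : IntegrableOn
    (fun t : ℝ ↦ ((Int.fract t : ℝ) : ℂ) * (t : ℂ) ^ (-(s + 1))) (Ioi 1) := by
  have h := integrableOn_Ioi_cpow_of_lt (a := -(s + 1)) (by simp; linarith) zero_lt_one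
  refine Integrable.mono h ?_ ?_
  · exact ((measurable_ofReal.comp measurable_fract).mul
      (measurable_ofReal.pow_const _)).aestronglyMeasurable
  · refine Eventually.of_forall fun t ↦ ?_
    rw [norm_mul]
    exact mul_le_of_le_one_left (norm_nonneg _) (norm_fract_le t)

theorem riemannZeta₁_eq_of_one_lt_re {s : ℂ} (hs : 1 < s.re) :
    riemannZeta₁ s = s - s * (s - 1) * mellin fractIoc s := by
  have hs1 : s - 1 ≠ 0 := fun h ↦ by
    rw [sub_eq_zero] at h; rw [h] at hs; simp at hs
  have hA : ∫ t : ℝ in Ioi 1, (t : ℂ) ^ (-s) = 1 / (s - 1) := by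
    rw [integral_Ioi_cpow_of_lt (by simpa using hs) zero_lt_one]
    simp only [ofReal_one, one_cpow]
    rw [show -s + 1 = -(s - 1) by ring, neg_div_neg_eq]
  have hI := integrableOn_Ioi_cpow_of_lt (a := -s) (by simpa using hs) zero_lt_one
  have key : ∫ t : ℝ in Ioi 1, (⌊t⌋₊ : ℂ) * (t : ℂ) ^ (-(s + 1))
      = 1 / (s - 1) - mellin fractIoc s := by
    rw [← hA, mellin_fractIoc_eq_integral, ← integral_sub hI (fract_integrable (by linarith))]
    refine setIntegral_congr_fun measurableSet_Ioi fun t (ht : 1 < t) ↦ ?_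
    have ht0 : (t : ℂ) ≠ 0 := by exact_mod_cast (zero_lt_one.trans ht).ne'
    have h1 : (t : ℂ) ^ (-s) = t * (t : ℂ) ^ (-(s + 1)) := by
      rw [show -s = 1 + -(s + 1) by ring, cpow_add _ _ ht0, cpow_one]
    have h2 : (⌊t⌋₊ : ℂ) = (t : ℂ) - ((Int.fract t : ℝ) : ℂ) := by
      rw [← ofReal_natCast, natCast_floor_eq_intCast_floor (by linarith), ← ofReal_sub,
        Int.self_sub_fract]
    simp only [h1, h2]
    ring
  have hz := riemannZeta_eq_inv_sub_mul (s := s) (sub_ne_zero.1 hs1)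
  rw [riemannZeta_eq_integral hs, key] at hz
  field_simp at hz
  linear_combination -hz

theorem riemannZeta₁_eq {s : ℂ} (hs : 0 < s.re) :
    riemannZeta₁ s = s - s * (s - 1) * mellin fractIoc s := by
  have hopen : IsOpen {s : ℂ | 0 < s.re} := isOpen_lt continuous_const continuous_re
  have hf : AnalyticOnNhd ℂ riemannZeta₁ {s : ℂ | 0 < s.re} :=
    (differentiable_riemannZeta₁.differentiableOn).analyticOnNhd hopen
  have hg : AnalyticOnNhd ℂ (fun s ↦ s - s * (s - 1) * mellin fractIoc s)
      {s : ℂ | 0 < s.re} := by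
    refine DifferentiableOn.analyticOnNhd (fun z hz ↦ ?_) hopen
    have := differentiableAt_mellin_fractIoc hz
    exact DifferentiableAt.differentiableWithinAt (by fun_prop)
  refine hf.eqOn_of_preconnected_of_eventuallyEq (z₀ := 2) hg
    (convex_halfSpace_re_gt 0).isPreconnected (by simp) ?_ hs
  have : {s : ℂ | 1 < s.re} ∈ 𝓝 (2 : ℂ) :=
    (isOpen_lt continuous_const continuous_re).mem_nhds (by simp)
  filter_upwards [this] with z hz using riemannZeta₁_eq_of_one_lt_re hz

theorem norm_riemannZeta₁_le {s : ℂ} (hs : 0 < s.re) :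
    ‖riemannZeta₁ s‖ ≤ ‖s‖ + ‖s‖ * ‖s - 1‖ / s.re := by
  rw [riemannZeta₁_eq hs]
  refine (norm_sub_le _ _).trans ?_
  rw [norm_mul, norm_mul, ← mul_one_div]
  gcongr
  exact norm_mellin_fractIoc_le hs

/-! ### The functions `t ↦ {θ/t}` -/

theorem fract_one_div_eq {t : ℝ} (ht : 0 < t) : ((Int.fract (1 / t) : ℝ) : ℂ)
    = fractIoc t + indicator (Ioi 1) (fun t : ℝ ↦ (t : ℂ)⁻¹) t := by
  by_cases h : t ≤ 1
  · rw [fractIoc, indicator_of_mem (show t ∈ Ioc 0 1 from ⟨ht, h⟩),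
      indicator_of_notMem (by simpa using h), add_zero]
  · rw [fractIoc, indicator_of_notMem fun h' ↦ h h'.2, indicator_of_mem (by simpa using h),
      zero_add, Int.fract_eq_self.2, one_div, ofReal_inv]
    exact ⟨by positivity, by rw [div_lt_one ht]; exact not_le.1 h⟩

theorem hasMellin_indicator_inv {s : ℂ} (hs : s.re < 1) :
    HasMellin (indicator (Ioi 1) fun t : ℝ ↦ (t : ℂ)⁻¹) s (1 / (1 - s)) := by
  have h1 : (fun t : ℝ ↦ (t : ℂ) ^ (s - 1) • indicator (Ioi 1) (fun t : ℝ ↦ (t : ℂ)⁻¹) t)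
      = indicator (Ioi 1) (fun t : ℝ ↦ (t : ℂ) ^ (s - 2)) := by
    ext t
    by_cases h : 1 < t
    · have ht0 : (t : ℂ) ≠ 0 := by exact_mod_cast (zero_lt_one.trans h).ne'
      rw [indicator_of_mem (show t ∈ Ioi 1 from h), indicator_of_mem (show t ∈ Ioi 1 from h),
        smul_eq_mul, ← cpow_neg_one, ← cpow_add _ _ ht0]
      ring_nf
    · simp [h]
  have hre : (s - 2).re < -1 := by simp; linarith
  have hsub : Ioi (0 : ℝ) ∩ Ioi 1 = Ioi 1 :=
    inter_eq_right.2 (Ioi_subset_Ioi zero_le_one)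
  constructor
  · rw [MellinConvergent, h1]
    exact ((integrableOn_Ioi_cpow_of_lt hre zero_lt_one).integrable_indicator
      measurableSet_Ioi).integrableOn
  · rw [mellin, h1, setIntegral_indicator measurableSet_Ioi, hsub,
      integral_Ioi_cpow_of_lt hre zero_lt_one]
    simp only [ofReal_one, one_cpow]
    rw [show s - 2 + 1 = -(1 - s) by ring, neg_div_neg_eq]

theorem hasMellin_fract_one_div {s : ℂ} (hs : 0 < s.re) (hs' : s.re < 1) :
    HasMellin (fun t : ℝ ↦ ((Int.fract (1 / t) : ℝ) : ℂ)) s (-(riemannZeta s / s)) := by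
  have h := hasMellin_add (mellinConvergent_fractIoc hs) (hasMellin_indicator_inv hs').1
  have hs0 : s ≠ 0 := fun h ↦ by simp [h] at hs
  have hs1 : s ≠ 1 := fun h ↦ by simp [h] at hs'
  have hs1' : s - 1 ≠ 0 := sub_ne_zero.2 hs1
  have hs1'' : 1 - s ≠ 0 := sub_ne_zero.2 hs1.symm
  have hval : mellin fractIoc s + mellin (indicator (Ioi 1) fun t : ℝ ↦ (t : ℂ)⁻¹) s
      = -(riemannZeta s / s) := by
    rw [(hasMellin_indicator_inv hs').2, riemannZeta_eq_inv_sub_mul hs1, riemannZeta₁_eq hs,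
      show 1 - s = -(s - 1) by ring]
    field_simp
    ring
  rw [hval] at h
  have heq : EqOn (fun t : ℝ ↦ (t : ℂ) ^ (s - 1) •
      (fractIoc t + indicator (Ioi 1) (fun t : ℝ ↦ (t : ℂ)⁻¹) t))
      (fun t : ℝ ↦ (t : ℂ) ^ (s - 1) • ((Int.fract (1 / t) : ℝ) : ℂ)) (Ioi 0) := fun t ht ↦ by
    simp only [fract_one_div_eq ht]
  exact ⟨h.1.congr_fun heq measurableSet_Ioi,
    (setIntegral_congr_fun measurableSet_Ioi heq).symm.trans h.2⟩

theorem hasMellin_fract_div {θ : ℝ} (hθ : 0 < θ) {s : ℂ} (hs : 0 < s.re) (hs' : s.re < 1) :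
    HasMellin (fun t : ℝ ↦ ((Int.fract (θ / t) : ℝ) : ℂ)) s
      (-((θ : ℂ) ^ s * (riemannZeta s / s))) := by
  have h := hasMellin_fract_one_div hs hs'
  have hθ' : 0 < θ⁻¹ := inv_pos.2 hθ
  have hfun : (fun t : ℝ ↦ ((Int.fract (θ / t) : ℝ) : ℂ))
      = fun t : ℝ ↦ (fun t : ℝ ↦ ((Int.fract (1 / t) : ℝ) : ℂ)) (θ⁻¹ * t) := by
    ext t
    simp only [one_div, mul_inv, inv_inv]
    rfl
  rw [hfun]
  refine ⟨(MellinConvergent.comp_mul_left hθ').2 h.1, ?_⟩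
  rw [mellin_comp_mul_left (fun t : ℝ ↦ ((Int.fract (1 / t) : ℝ) : ℂ)) _ hθ', h.2, smul_eq_mul,
    ofReal_inv, cpow_neg, inv_cpow, inv_inv]
  · ring
  · rw [arg_ofReal_of_nonneg hθ.le]; exact Real.pi_pos.ne

theorem memLp_two_of_norm_le {f : ℝ → ℂ} (hf : Measurable f) {C : ℝ} 
    (h1 : ∀ t ∈ Ioc (0 : ℝ) 1, ‖f t‖ ≤ C) (h2 : ∀ t ∈ Ioi (1 : ℝ), ‖f t‖ ≤ C / t) :
    MemLp f 2 (volume.restrict (Ioi 0)) := by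
  rw [memLp_two_iff_integrable_sq_norm hf.aestronglyMeasurable]
  change IntegrableOn _ _ _
  rw [← Ioc_union_Ioi_eq_Ioi zero_le_one]
  have hm : Measurable fun t ↦ ‖f t‖ ^ 2 := hf.norm.pow_const 2
  refine IntegrableOn.union ?_ ?_
  · refine Measure.integrableOn_of_bounded (M := C ^ 2) (by simp) hm.aestronglyMeasurable ?_
    refine (ae_restrict_mem measurableSet_Ioc).mono fun t ht ↦ ?_
    rw [Real.norm_of_nonneg (by positivity)]
    gcongr
    exact h1 t ht
  · have h := (integrableOn_Ioi_rpow_of_lt (a := -2) (by norm_num) zero_lt_one).const_mul (C ^ 2)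
    refine Integrable.mono' h hm.aestronglyMeasurable ?_
    refine (ae_restrict_mem measurableSet_Ioi).mono fun t (ht : 1 < t) ↦ ?_
    rw [Real.norm_of_nonneg (by positivity), Real.rpow_neg (by linarith), ← div_eq_mul_inv]
    norm_cast
    rw [← div_pow]
    gcongr
    exact h2 t ht

theorem memLp_fract_div {θ : ℝ} (hθ : 0 < θ) (hθ' : θ ≤ 1) :
    MemLp (fun t : ℝ ↦ ((Int.fract (θ / t) : ℝ) : ℂ)) 2 (volume.restrict (Ioi 0)) := by
  refine memLp_two_of_norm_le (measurable_fract_div θ) (C := 1) (fun t _ ↦ norm_fract_le _)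
    fun t (ht : 1 < t) ↦ ?_
  rw [Int.fract_eq_self.2, norm_real, Real.norm_of_nonneg (by positivity)]
  · gcongr
  · exact ⟨by positivity, by rw [div_lt_one (by linarith)]; linarith⟩

/-! ### Approximability implies the Riemann Hypothesis -/

/-- A square-integrable function orthogonal to every `{θ/t}` when `s` is a zero of zeta. -/
noncomputable def annihilator (s : ℂ) : ℝ → ℂ :=
  indicator (Ioc 0 1) (fun t : ℝ ↦ (t : ℂ) ^ (s - 1)) +
    indicator (Ioi 1) (fun t : ℝ ↦ (1 - s)⁻¹ * (t : ℂ)⁻¹)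

theorem annihilator_of_le {s : ℂ} {t : ℝ} (ht : t ∈ Ioc (0 : ℝ) 1) :
    annihilator s t = (t : ℂ) ^ (s - 1) := by
  simp [annihilator, ht, ht.2]

theorem annihilator_of_lt {s : ℂ} {t : ℝ} (ht : t ∈ Ioi (1 : ℝ)) :
    annihilator s t = (1 - s)⁻¹ * (t : ℂ)⁻¹ := by
  have : 1 < t := ht
  simp [annihilator, this, not_le.2 this]

theorem memLp_annihilator {s : ℂ} (hs : 1 / 2 < s.re) :
    MemLp (annihilator s) 2 (volume.restrict (Ioi 0)) := by
  have hm : Measurable (annihilator s) :=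
    ((measurable_ofReal.pow_const _).indicator measurableSet_Ioc).add
      ((measurable_ofReal.inv.const_mul _).indicator measurableSet_Ioi)
  rw [memLp_two_iff_integrable_sq_norm hm.aestronglyMeasurable]
  change IntegrableOn _ _ _
  rw [← Ioc_union_Ioi_eq_Ioi zero_le_one]
  refine IntegrableOn.union ?_ ?_
  · have := intervalIntegral.intervalIntegrable_rpow' (a := 0) (b := 1) (r := 2 * (s.re - 1))
      (by linarith)
    rw [intervalIntegrable_iff_integrableOn_Ioc_of_le zero_le_one] at this
    refine this.congr_fun (fun t ht ↦ ?_) measurableSet_Ioc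
    rw [annihilator_of_le ht, norm_cpow_eq_rpow_re_of_pos ht.1, ← Real.rpow_mul_natCast ht.1.le]
    simp [mul_comm]
  · have h := (integrableOn_Ioi_rpow_of_lt (a := -2) (by norm_num) zero_lt_one).const_mul
      (‖(1 - s)⁻¹‖ ^ 2)
    refine IntegrableOn.congr_fun h (fun t ht ↦ ?_) measurableSet_Ioi
    have ht' : (1 : ℝ) < t := ht
    simp only [annihilator_of_lt ht]
    rw [Real.rpow_neg (by linarith), norm_mul, mul_pow, norm_inv (t : ℂ), norm_real,
      Real.norm_of_nonneg (by linarith), inv_pow]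
    norm_cast

theorem integral_fract_mul_annihilator {s : ℂ} (hs : 0 < s.re) (hs' : s.re < 1)
    (hz : riemannZeta s = 0) {θ : ℝ} (hθ : 0 < θ) (hθ' : θ ≤ 1) :
    ∫ t in Ioi (0 : ℝ), ((Int.fract (θ / t) : ℝ) : ℂ) * annihilator s t = 0 := by
  have h1 := hasMellin_fract_div hθ hs hs'
  have hs1 : 1 - s ≠ 0 := fun h ↦ by
    rw [sub_eq_zero] at h; simp [← h] at hs'
  simp only [hz, zero_div, mul_zero, neg_zero] at h1
  have h2 := h1.2
  have hre : (s - 2).re < -1 := by simp; linarith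
  have hre' : (-2 : ℂ).re < -1 := by simp
  have hi := (integrableOn_Ioi_cpow_of_lt hre zero_lt_one).const_mul (θ : ℂ)
  have hi' := (integrableOn_Ioi_cpow_of_lt hre' zero_lt_one).const_mul ((θ : ℂ) * (1 - s)⁻¹)
  have hdis : Disjoint (Ioc (0 : ℝ) 1) (Ioi 1) := Ioc_disjoint_Ioi le_rfl
  have hfr {t : ℝ} (ht : t ∈ Ioi (1 : ℝ)) : ((Int.fract (θ / t) : ℝ) : ℂ) = θ * (t : ℂ)⁻¹ := by
    have ht' : (1 : ℝ) < t := ht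
    rw [Int.fract_eq_self.2, ofReal_div, div_eq_mul_inv]
    exact ⟨by positivity, by rw [div_lt_one (by linarith)]; linarith⟩
  have hA : EqOn (fun t : ℝ ↦ (t : ℂ) ^ (s - 1) • ((Int.fract (θ / t) : ℝ) : ℂ))
      (fun t ↦ ((Int.fract (θ / t) : ℝ) : ℂ) * annihilator s t) (Ioc 0 1) := fun t ht ↦ by
    simp only [annihilator_of_le ht, smul_eq_mul, mul_comm]
  have hB : EqOn (fun t : ℝ ↦ (t : ℂ) ^ (s - 1) • ((Int.fract (θ / t) : ℝ) : ℂ))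
      (fun t : ℝ ↦ (θ : ℂ) * (t : ℂ) ^ (s - 2)) (Ioi 1) := fun t ht ↦ by
    have ht' : (1 : ℝ) < t := ht
    have ht0 : (t : ℂ) ≠ 0 := by exact_mod_cast (zero_lt_one.trans ht').ne'
    simp only [hfr ht, smul_eq_mul]
    rw [show s - 1 = s - 2 + 1 by ring, cpow_add _ _ ht0, cpow_one]
    field_simp
  have hC : EqOn (fun t : ℝ ↦ ((Int.fract (θ / t) : ℝ) : ℂ) * annihilator s t)
      (fun t : ℝ ↦ (θ : ℂ) * (1 - s)⁻¹ * (t : ℂ) ^ (-2 : ℂ)) (Ioi 1) := fun t ht ↦ by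
    have ht' : (1 : ℝ) < t := ht
    have ht0 : (t : ℂ) ≠ 0 := by exact_mod_cast (zero_lt_one.trans ht').ne'
    simp only [hfr ht, annihilator_of_lt ht, cpow_neg]
    norm_cast
    push_cast
    field_simp
  have hint := h1.1
  rw [MellinConvergent, ← Ioc_union_Ioi_eq_Ioi zero_le_one] at hint
  rw [mellin, ← Ioc_union_Ioi_eq_Ioi zero_le_one, setIntegral_union hdis measurableSet_Ioi
    hint.left_of_union hint.right_of_union, setIntegral_congr_fun measurableSet_Ioc hA,
    setIntegral_congr_fun measurableSet_Ioi hB] at h2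
  rw [← Ioc_union_Ioi_eq_Ioi zero_le_one, setIntegral_union hdis measurableSet_Ioi
    (hint.left_of_union.congr_fun hA measurableSet_Ioc)
    (IntegrableOn.congr_fun hi' hC.symm measurableSet_Ioi),
    setIntegral_congr_fun measurableSet_Ioi hC]
  rw [← h2]
  congr 1
  rw [integral_const_mul, integral_const_mul, integral_Ioi_cpow_of_lt hre zero_lt_one,
    integral_Ioi_cpow_of_lt hre' zero_lt_one]
  simp only [ofReal_one, one_cpow]
  rw [show s - 2 + 1 = -(1 - s) by ring]
  rw [show (-2 : ℂ) + 1 = -1 by norm_num]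
  field_simp

theorem integral_indicator_mul_annihilator {s : ℂ} (hs : 0 < s.re) :
    ∫ t in Ioi (0 : ℝ), indicator (Ioc (0 : ℝ) 1) (fun _ ↦ (1 : ℂ)) t * annihilator s t
      = 1 / s := by
  rw [← (hasMellin_one_Ioc hs).2, mellin]
  refine setIntegral_congr_fun measurableSet_Ioi fun t _ ↦ ?_
  by_cases h : t ∈ Ioc (0 : ℝ) 1
  · simp [annihilator_of_le h, indicator_of_mem h]
  · simp [indicator_of_notMem h]

theorem mem_span_fract {lam : ℝ} (hlam : 0 < lam) {f : ℝ → ℂ}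
    (hf : f ∈ Submodule.span ℂ {g : ℝ → ℂ | ∃ θ : ℝ, lam ≤ θ ∧ θ ≤ 1 ∧
      g = fun t => ((Int.fract (θ / t) : ℝ) : ℂ)}) {s : ℂ} (hs : 1 / 2 < s.re) (hs' : s.re < 1)
    (hz : riemannZeta s = 0) :
    MemLp f 2 (volume.restrict (Ioi 0)) ∧ ∫ t in Ioi (0 : ℝ), f t * annihilator s t = 0 := by
  have hk := memLp_annihilator hs
  induction hf using Submodule.span_induction with
  | mem g hg =>
    obtain ⟨θ, h1, h2, rfl⟩ := hg
    exact ⟨memLp_fract_div (hlam.trans_le h1) h2,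
      integral_fract_mul_annihilator (by linarith) hs' hz (hlam.trans_le h1) h2⟩
  | zero => exact ⟨MemLp.zero, by simp⟩
  | add f g _ _ hf hg =>
    refine ⟨hf.1.add hg.1, ?_⟩
    have h1 : IntegrableOn (fun t ↦ f t * annihilator s t) (Ioi 0) := hf.1.integrable_mul hk
    have h2 : IntegrableOn (fun t ↦ g t * annihilator s t) (Ioi 0) := hg.1.integrable_mul hk
    simp only [Pi.add_apply, add_mul]
    rw [integral_add h1 h2, hf.2, hg.2, add_zero]
  | smul c f _ hf =>
    refine ⟨hf.1.const_smul c, ?_⟩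
    simp only [Pi.smul_apply, smul_eq_mul, mul_assoc]
    rw [integral_const_mul, hf.2, mul_zero]

theorem memLp_indicator_Ioc : MemLp (fun t ↦ indicator (Ioc (0 : ℝ) 1) (fun _ ↦ (1 : ℂ)) t) 2
    (volume.restrict (Ioi 0)) :=
  memLp_two_of_norm_le (measurable_const.indicator measurableSet_Ioc) (C := 1)
    (fun t ht ↦ by simp [indicator_of_mem ht]) fun t (ht : 1 < t) ↦ by
      simp [not_le.2 ht]; linarith

/-- The approximation condition of the Nyman–Beurling criterion. -/
def IndicatorApproximable : Prop :=
  ∀ ε : ℝ, 0 < ε → ∃ lam : ℝ, 0 < lam ∧ lam < 1 ∧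
    ∃ f ∈ Submodule.span ℂ
        {g : ℝ → ℂ | ∃ θ : ℝ, lam ≤ θ ∧ θ ≤ 1 ∧
          g = fun t => ((Int.fract (θ / t) : ℝ) : ℂ)},
      eLpNorm
          (fun t => Set.indicator (Set.Ioc (0:ℝ) 1) (fun _ => (1:ℂ)) t - f t) 2
          (volume.restrict (Set.Ioi (0:ℝ)))
        < ENNReal.ofReal ε

theorem riemannZeta_ne_zero_of_approximable (h : IndicatorApproximable) {s : ℂ}
    (hs : 1 / 2 < s.re) (hs' : s.re < 1) : riemannZeta s ≠ 0 := by
  intro hz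
  have hk := memLp_annihilator hs
  have hs0 : s ≠ 0 := fun h ↦ by norm_num [h] at hs
  set K := (eLpNorm (annihilator s) 2 (volume.restrict (Ioi 0))).toReal with hK
  have hK0 : 0 ≤ K := ENNReal.toReal_nonneg
  have hpos : 0 < ‖1 / s‖ := by simpa using hs0
  obtain ⟨lam, hl, -, f, hf, hlt⟩ := h (‖1 / s‖ / (K + 1)) (by positivity)
  obtain ⟨hf2, hf0⟩ := mem_span_fract hl hf hs hs' hz
  have hχ := memLp_indicator_Ioc
  set χ : ℝ → ℂ := fun t ↦ indicator (Ioc (0 : ℝ) 1) (fun _ ↦ (1 : ℂ)) t with hχdef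
  have hd := hχ.sub hf2
  have h1 : IntegrableOn (fun t ↦ χ t * annihilator s t) (Ioi 0) := hχ.integrable_mul hk
  have h2 : IntegrableOn (fun t ↦ f t * annihilator s t) (Ioi 0) := hf2.integrable_mul hk
  have hint : ∫ t in Ioi (0 : ℝ), ((χ - f) • annihilator s) t = 1 / s := by
    have h3 := integral_sub h1 h2
    rw [hf0, sub_zero, integral_indicator_mul_annihilator (by linarith)] at h3
    rw [← h3]
    congr 1 with t
    simp [hχdef, sub_mul]
  have hle : ‖1 / s‖ₑ ≤ eLpNorm (χ - f) 2 (volume.restrict (Ioi 0)) *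
      eLpNorm (annihilator s) 2 (volume.restrict (Ioi 0)) := by
    rw [← hint]
    refine (enorm_integral_le_lintegral_enorm _).trans ?_
    rw [← eLpNorm_one_eq_lintegral_enorm]
    exact eLpNorm_smul_le_mul_eLpNorm hk.1 hd.1
  have hle2 : ‖1 / s‖ ≤ ‖1 / s‖ / (K + 1) * K := by
    have := ENNReal.toReal_mono (ENNReal.mul_ne_top hd.2.ne hk.2.ne) hle
    rw [ENNReal.toReal_mul, toReal_enorm, ← hK] at this
    refine this.trans (mul_le_mul_of_nonneg_right ?_ hK0)
    exact ENNReal.toReal_le_of_le_ofReal (by positivity) hlt.le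
  rw [div_mul_eq_mul_div, le_div_iff₀ (by positivity)] at hle2
  nlinarith

theorem riemannHypothesis_of_approximable (h : IndicatorApproximable) : RiemannHypothesis := by
  have key : ∀ s : ℂ, 1 / 2 < s.re → riemannZeta s ≠ 0 := fun s hs ↦ by
    rcases lt_or_ge s.re 1 with h1 | h1
    · exact riemannZeta_ne_zero_of_approximable h hs h1
    · exact riemannZeta_ne_zero_of_one_le_re h1
  intro s hz htriv _
  rcases lt_trichotomy s.re (1 / 2) with hlt | heq | hgt
  · exfalso
    have hs0 : s ≠ 0 := fun h ↦ by
      rw [h, riemannZeta_zero] at hz; norm_num at hz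
    set w := 1 - s with hw
    have hwre : 1 / 2 < w.re := by simp [hw]; linarith
    have hzw : riemannZeta (1 - w) = 0 := by rw [hw, sub_sub_cancel, hz]
    rw [riemannZeta_one_sub (fun n h ↦ by
      rw [h] at hwre; simp at hwre
      have : (0 : ℝ) ≤ n := n.cast_nonneg
      linarith) (fun h ↦ hs0 (by rw [hw] at h; linear_combination -h))] at hzw
    have hG : Gamma w ≠ 0 := Gamma_ne_zero_of_re_pos (by linarith)
    have hpi : (2 * Real.pi : ℂ) ^ (-w) ≠ 0 := by
      rw [Ne, cpow_eq_zero_iff]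
      simp [Real.pi_ne_zero]
    have hc : Complex.cos (Real.pi * w / 2) = 0 := by
      simpa [hG, hpi, key w hwre] using hzw
    obtain ⟨k, hk⟩ := Complex.cos_eq_zero_iff.1 hc
    have hpi' : (Real.pi : ℂ) ≠ 0 := ofReal_ne_zero.2 Real.pi_ne_zero
    have hwk : w = 2 * k + 1 := by
      field_simp at hk
      exact hk
    have hk0 : 0 ≤ k := by
      rw [hwk] at hwre
      have : (-1 : ℝ) < k := by simp at hwre; linarith
      have : (-1 : ℤ) < k := by exact_mod_cast this
      omega
    have hsk : s = -2 * k := by rw [hw] at hwk; linear_combination -hwk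
    have hk1 : k ≠ 0 := fun h ↦ hs0 (by rw [hsk, h]; simp)
    refine htriv ⟨(k - 1).toNat, ?_⟩
    rw [hsk]
    have h5 : (((k - 1).toNat : ℤ) : ℂ) = ((k - 1 : ℤ) : ℂ) := by
      rw [Int.toNat_of_nonneg (by omega)]
    rw [Int.cast_natCast] at h5
    rw [h5]; push_cast; ring
  · exact heq
  · exact absurd hz (key s hgt)

/-! ### Approximation on the critical line -/

theorem tendsto_eLpNorm_sub_of_dominated {F : ℕ → ℝ → ℂ} {f : ℝ → ℂ} {g : ℝ → ℝ}
    (hg : MemLp g 2) (hF : ∀ n, AEStronglyMeasurable (F n)) (hb : ∀ n, ∀ᵐ t, ‖F n t‖ ≤ g t)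
    (hlim : ∀ᵐ t, Tendsto (fun n ↦ F n t) atTop (𝓝 (f t))) :
    Tendsto (fun n ↦ eLpNorm (f - F n) 2) atTop (𝓝 0) := by
  have hf : AEStronglyMeasurable f := aestronglyMeasurable_of_tendsto_ae atTop hF hlim
  have h1 : Tendsto (fun n ↦ ∫⁻ t, ‖(f - F n) t‖ₑ ^ (2 : ℝ)) atTop (𝓝 (∫⁻ _ : ℝ, 0)) := by
    have hgfin : ∫⁻ t, (2 * ‖g t‖ₑ) ^ (2 : ℝ) ≠ ⊤ := by
      have h2 : MemLp (fun t ↦ (2 : ℝ) * g t) 2 := hg.const_mul 2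
      have h3 := lintegral_rpow_enorm_lt_top_of_eLpNorm_lt_top two_ne_zero ENNReal.ofNat_ne_top
        h2.2
      refine ne_of_lt (lt_of_eq_of_lt ?_ h3)
      congr 1 with t
      rw [enorm_mul, Real.enorm_of_nonneg zero_le_two]
      simp
    refine tendsto_lintegral_of_dominated_convergence' (fun t ↦ (2 * ‖g t‖ₑ) ^ (2 : ℝ))
      (fun n ↦ (hf.sub (hF n)).enorm.pow_const _) (fun n ↦ ?_) hgfin ?_
    · filter_upwards [hlim, ae_all_iff.2 hb] with t ht hbt
      have h4 : ‖f t‖ ≤ g t := le_of_tendsto ht.norm (Eventually.of_forall hbt)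
      refine ENNReal.rpow_le_rpow ?_ (by norm_num)
      have h5 : ∀ z : ℂ, ‖z‖ ≤ g t → ‖z‖ₑ ≤ ‖g t‖ₑ := fun z hz ↦
        enorm_le_iff_norm_le.2 (hz.trans (le_abs_self _))
      calc ‖f t - F n t‖ₑ ≤ ‖f t‖ₑ + ‖F n t‖ₑ := enorm_sub_le
        _ ≤ ‖g t‖ₑ + ‖g t‖ₑ := add_le_add (h5 _ h4) (h5 _ (hbt n))
        _ = 2 * ‖g t‖ₑ := (two_mul _).symm
    · filter_upwards [hlim] with t ht
      have h6 : Tendsto (fun n ↦ ‖f t - F n t‖ₑ) atTop (𝓝 ‖f t - f t‖ₑ) :=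
        (tendsto_const_nhds.sub ht).enorm
      have h7 := (ENNReal.continuous_rpow_const (y := (2 : ℝ))).continuousAt.tendsto.comp h6
      simpa [Function.comp_def] using h7
  rw [lintegral_zero] at h1
  have h8 := (ENNReal.continuous_rpow_const (y := (1 / 2 : ℝ))).continuousAt.tendsto.comp h1
  rw [ENNReal.zero_rpow_of_pos (by norm_num)] at h8
  refine h8.congr fun n ↦ ?_
  rw [eLpNorm_eq_lintegral_rpow_enorm_toReal two_ne_zero ENNReal.ofNat_ne_top]
  simp

/-- The function `ζ(s)/s` on the critical line. -/
noncomputable def critZeta (t : ℝ) : ℂ := riemannZeta (critLine t) / critLine t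

theorem critLine_ne_one (t : ℝ) : critLine t ≠ 1 := fun h ↦ by
  have := critLine_re t
  rw [h] at this; norm_num at this

theorem critLine_ne_zero (t : ℝ) : critLine t ≠ 0 := fun h ↦ by
  have := critLine_re t
  rw [h] at this; norm_num at this

theorem continuous_critZeta : Continuous critZeta :=
  continuous_iff_continuousAt.2 fun t ↦
    ((differentiableAt_riemannZeta (critLine_ne_one t)).continuousAt.comp
      continuous_critLine.continuousAt).div continuous_critLine.continuousAt (critLine_ne_zero t)

theorem mellin_fract_critLine {θ : ℝ} (hθ : 0 < θ) (t : ℝ) :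
    mellin (fun t : ℝ ↦ ((Int.fract (θ / t) : ℝ) : ℂ)) (critLine t)
      = -((θ : ℂ) ^ critLine t * critZeta t) :=
  (hasMellin_fract_div hθ (by rw [critLine_re]; norm_num) (by rw [critLine_re]; norm_num)).2

theorem memLp_critZeta : MemLp critZeta 2 := by
  refine ⟨continuous_critZeta.aestronglyMeasurable, ?_⟩
  have h := eLpNorm_mellin_critLine (hasMellin_fract_div zero_lt_one (s := 1 / 2)
    (by norm_num) (by norm_num)).1 (memLp_fract_div zero_lt_one le_rfl)
  have h2 : (fun t ↦ mellin (fun t : ℝ ↦ ((Int.fract (1 / t) : ℝ) : ℂ)) (critLine t))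
      = -critZeta := by
    ext t
    rw [mellin_fract_critLine zero_lt_one]
    simp
  rw [h2, eLpNorm_neg] at h
  rw [h]
  exact (memLp_fract_div zero_lt_one le_rfl).2

/-- The span of the functions `θ ^ s` on the critical line, `0 < θ ≤ 1`. -/
noncomputable def powSpan : Submodule ℂ (ℝ → ℂ) :=
  Submodule.span ℂ {g | ∃ θ : ℝ, 0 < θ ∧ θ ≤ 1 ∧ g = fun t ↦ (θ : ℂ) ^ critLine t}

theorem mul_mem_powSpan {P Q : ℝ → ℂ} (hP : P ∈ powSpan) (hQ : Q ∈ powSpan) :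
    P * Q ∈ powSpan := by
  induction hP, hQ using Submodule.span_induction₂ with
  | mem_mem x y hx hy =>
    obtain ⟨a, ha, ha', rfl⟩ := hx
    obtain ⟨b, hb, hb', rfl⟩ := hy
    refine Submodule.subset_span ⟨a * b, mul_pos ha hb, mul_le_one₀ ha' hb.le hb', ?_⟩
    ext t
    simp [mul_cpow_ofReal_nonneg ha.le hb.le]
  | zero_left y hy => simp
  | zero_right x hx => simp
  | add_left x y z _ _ _ h1 h2 => rw [add_mul]; exact add_mem h1 h2
  | add_right x y z _ _ _ h1 h2 => rw [mul_add]; exact add_mem h1 h2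
  | smul_left r x y _ _ h => rw [smul_mul_assoc]; exact Submodule.smul_mem _ _ h
  | smul_right r x y _ _ h => rw [mul_smul_comm]; exact Submodule.smul_mem _ _ h

theorem one_mem_powSpan : (1 : ℝ → ℂ) ∈ powSpan :=
  Submodule.subset_span ⟨1, zero_lt_one, le_rfl, by ext t; simp⟩

theorem powSpan_bounded {P : ℝ → ℂ} (hP : P ∈ powSpan) :
    Measurable P ∧ ∃ C : ℝ, ∀ t, ‖P t‖ ≤ C := by
  induction hP using Submodule.span_induction with
  | mem x hx =>
    obtain ⟨θ, h0, h1, rfl⟩ := hx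
    refine ⟨continuous_critLine.measurable.const_pow _, 1, fun t ↦ ?_⟩
    rw [norm_cpow_eq_rpow_re_of_pos h0, critLine_re]
    exact Real.rpow_le_one h0.le h1 (by norm_num)
  | zero => exact ⟨measurable_const, 0, fun t ↦ by simp⟩
  | add x y _ _ hx hy =>
    obtain ⟨h1, C, hC⟩ := hx
    obtain ⟨h2, D, hD⟩ := hy
    exact ⟨h1.add h2, C + D, fun t ↦ norm_add_le_of_le (hC t) (hD t)⟩
  | smul c x _ hx =>
    obtain ⟨h1, C, hC⟩ := hx
    refine ⟨h1.const_smul c, ‖c‖ * C, fun t ↦ ?_⟩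
    rw [Pi.smul_apply, norm_smul]
    exact mul_le_mul_of_nonneg_left (hC t) (norm_nonneg c)

/-- `V` lies in the `L²`-closure of `powSpan * critZeta`. -/
def Approachable (V : ℝ → ℂ) : Prop :=
  AEStronglyMeasurable V ∧
    ∀ ε : ℝ≥0∞, 0 < ε → ∃ P ∈ powSpan, eLpNorm (V - P * critZeta) 2 ≤ ε

theorem aestronglyMeasurable_mul_critZeta {P : ℝ → ℂ} (hP : Measurable P) :
    AEStronglyMeasurable (P * critZeta) :=
  hP.aestronglyMeasurable.mul continuous_critZeta.aestronglyMeasurable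

theorem approachable_of_mem_powSpan {P : ℝ → ℂ} (hP : P ∈ powSpan) :
    Approachable (P * critZeta) :=
  ⟨aestronglyMeasurable_mul_critZeta (powSpan_bounded hP).1, fun ε _ ↦ ⟨P, hP, by simp⟩⟩

theorem approachable_of_forall {V : ℝ → ℂ} (hV : AEStronglyMeasurable V)
    (h : ∀ ε : ℝ≥0∞, 0 < ε → ∃ V', Approachable V' ∧ eLpNorm (V - V') 2 ≤ ε) :
    Approachable V := by
  refine ⟨hV, fun ε hε ↦ ?_⟩
  obtain ⟨V', ⟨hV', h1⟩, h2⟩ := h (ε / 2) (ENNReal.half_pos hε.ne')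
  obtain ⟨P, hP, h3⟩ := h1 (ε / 2) (ENNReal.half_pos hε.ne')
  refine ⟨P, hP, ?_⟩
  rw [← sub_add_sub_cancel V V' (P * critZeta), ← ENNReal.add_halves ε]
  have hm := aestronglyMeasurable_mul_critZeta (powSpan_bounded hP).1
  exact (eLpNorm_add_le (hV.sub hV') (hV'.sub hm) one_le_two).trans (add_le_add h2 h3)

theorem approachable_of_tendsto {F : ℕ → ℝ → ℂ} {f : ℝ → ℂ} {g : ℝ → ℝ}
    (hg : MemLp g 2) (hF : ∀ n, Approachable (F n)) (hb : ∀ n, ∀ᵐ t, ‖F n t‖ ≤ g t)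
    (hlim : ∀ᵐ t, Tendsto (fun n ↦ F n t) atTop (𝓝 (f t))) : Approachable f := by
  refine approachable_of_forall
    (aestronglyMeasurable_of_tendsto_ae atTop (fun n ↦ (hF n).1) hlim) fun ε hε ↦ ?_
  have h := tendsto_eLpNorm_sub_of_dominated hg (fun n ↦ (hF n).1) hb hlim
  obtain ⟨n, hn⟩ := (h.eventually (ge_mem_nhds hε)).exists
  exact ⟨F n, hF n, hn⟩

theorem Approachable.bounded_mul {V P : ℝ → ℂ} {C : ℝ} (hV : Approachable V)
    (hP : Measurable P) (hC : ∀ t, ‖P t‖ ≤ C)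
    (h : ∀ Q ∈ powSpan, Approachable (P * (Q * critZeta))) : Approachable (P * V) := by
  refine approachable_of_forall (hP.aestronglyMeasurable.mul hV.1) fun ε hε ↦ ?_
  have hC0 : 0 ≤ C := (norm_nonneg _).trans (hC 0)
  have hpos : ENNReal.ofReal (C + 1) ≠ 0 := by simp; linarith
  obtain ⟨Q, hQ, hle⟩ := hV.2 (ε / ENNReal.ofReal (C + 1))
    (ENNReal.div_pos hε.ne' ENNReal.ofReal_ne_top)
  refine ⟨_, h Q hQ, ?_⟩
  rw [← mul_sub]
  refine (eLpNorm_le_mul_eLpNorm_of_ae_le_mul (c := C + 1) (g := V - Q * critZeta)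
    (Eventually.of_forall fun t ↦ ?_) 2).trans ?_
  · rw [Pi.mul_apply, norm_mul]
    exact mul_le_mul_of_nonneg_right ((hC t).trans (by linarith)) (norm_nonneg _)
  · refine (mul_le_mul_right hle _).trans ?_
    exact ENNReal.mul_div_le

theorem Approachable.add {U V : ℝ → ℂ} (hU : Approachable U) (hV : Approachable V) :
    Approachable (U + V) := by
  refine ⟨hU.1.add hV.1, fun ε hε ↦ ?_⟩
  obtain ⟨P, hP, h1⟩ := hU.2 (ε / 2) (ENNReal.half_pos hε.ne')
  obtain ⟨Q, hQ, h2⟩ := hV.2 (ε / 2) (ENNReal.half_pos hε.ne')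
  refine ⟨P + Q, add_mem hP hQ, ?_⟩
  rw [add_mul, add_sub_add_comm, ← ENNReal.add_halves ε]
  refine (eLpNorm_add_le (hU.1.sub ?_) (hV.1.sub ?_) one_le_two).trans (add_le_add h1 h2)
  · exact aestronglyMeasurable_mul_critZeta (powSpan_bounded hP).1
  · exact aestronglyMeasurable_mul_critZeta (powSpan_bounded hQ).1

/-- The algebra of bounded multipliers `p` such that `p * critZeta` is approachable. -/
noncomputable def multipliers : Subalgebra ℂ (ℝ → ℂ) where
  carrier := {p | Measurable p ∧ (∃ C : ℝ, ∀ t, ‖p t‖ ≤ C) ∧ Approachable (p * critZeta)}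
  mul_mem' := by
    rintro p q ⟨hp, ⟨C, hC⟩, hpA⟩ ⟨hq, ⟨D, hD⟩, hqA⟩
    refine ⟨hp.mul hq, ⟨C * D, fun t ↦ ?_⟩, ?_⟩
    · rw [Pi.mul_apply, norm_mul]
      exact mul_le_mul (hC t) (hD t) (norm_nonneg _) ((norm_nonneg _).trans (hC t))
    · rw [mul_assoc]
      refine hqA.bounded_mul hp hC fun Q hQ ↦ ?_
      obtain ⟨hQm, E, hE⟩ := powSpan_bounded hQ
      rw [mul_left_comm]
      refine hpA.bounded_mul hQm hE fun P hP ↦ ?_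
      rw [← mul_assoc]
      exact approachable_of_mem_powSpan (mul_mem_powSpan hQ hP)
  add_mem' := by
    rintro p q ⟨hp, ⟨C, hC⟩, hpA⟩ ⟨hq, ⟨D, hD⟩, hqA⟩
    refine ⟨hp.add hq, ⟨C + D, fun t ↦ norm_add_le_of_le (hC t) (hD t)⟩, ?_⟩
    rw [add_mul]
    exact hpA.add hqA
  algebraMap_mem' c := by
    refine ⟨measurable_const, ⟨‖c‖, fun t ↦ by simp⟩, ?_⟩
    rw [Algebra.algebraMap_eq_smul_one]
    exact approachable_of_mem_powSpan (Submodule.smul_mem _ _ one_mem_powSpan)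

theorem powSpan_le_multipliers {P : ℝ → ℂ} (hP : P ∈ powSpan) : P ∈ multipliers :=
  ⟨(powSpan_bounded hP).1, (powSpan_bounded hP).2, approachable_of_mem_powSpan hP⟩

theorem multipliers_of_tendsto {p : ℕ → ℝ → ℂ} {q : ℝ → ℂ} {C : ℝ}
    (hp : ∀ n, p n ∈ multipliers) (hC : ∀ n t, ‖p n t‖ ≤ C)
    (hlim : ∀ t, Tendsto (fun n ↦ p n t) atTop (𝓝 (q t))) : q ∈ multipliers := by
  refine ⟨measurable_of_tendsto_metrizable (fun n ↦ (hp n).1) (tendsto_pi_nhds.2 hlim),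
    ⟨C, fun t ↦ le_of_tendsto (hlim t).norm (Eventually.of_forall fun n ↦ hC n t)⟩, ?_⟩
  refine approachable_of_tendsto (g := fun t ↦ C * ‖critZeta t‖)
    (memLp_critZeta.norm.const_mul C) (fun n ↦ (hp n).2.2)
    (fun n ↦ Eventually.of_forall fun t ↦ ?_) (Eventually.of_forall fun t ↦ ?_)
  · rw [Pi.mul_apply, norm_mul]
    exact mul_le_mul_of_nonneg_right (hC n t) (norm_nonneg _)
  · exact (hlim t).mul_const _

/-! ### Bounded analytic functions are multipliers -/

theorem norm_exp_neg_mul_critLine (h t : ℝ) : ‖cexp (-h * critLine t)‖ = Real.exp (-(h / 2)) := by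
  rw [norm_exp]
  congr 1
  simp [critLine_re]
  ring

theorem le_one_sub_exp_neg {h : ℝ} (h0 : 0 < h) (h1 : h ≤ 1) :
    h / 3 ≤ 1 - Real.exp (-(h / 2)) := by
  have h2 := Real.add_one_le_exp (h / 2)
  have h3 : Real.exp (-(h / 2)) ≤ (h / 2 + 1)⁻¹ := by
    rw [Real.exp_neg]
    exact inv_anti₀ (by linarith) h2
  have h4 : (h / 2 + 1)⁻¹ ≤ 1 - h / 3 := by
    rw [inv_le_comm₀ (by linarith) (by linarith), inv_le_iff_one_le_mul₀ (by linarith)]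
    nlinarith
  linarith

theorem le_norm_one_sub_exp {h : ℝ} (h0 : 0 < h) (h1 : h ≤ 1) (t : ℝ) :
    h / 3 ≤ ‖1 - cexp (-h * critLine t)‖ := by
  refine (le_one_sub_exp_neg h0 h1).trans ?_
  rw [← norm_exp_neg_mul_critLine h t, ← norm_one (α := ℂ)]
  exact norm_sub_norm_le _ _

theorem exp_mem_multipliers {h : ℝ} (h0 : 0 ≤ h) :
    (fun t ↦ cexp (-h * critLine t)) ∈ multipliers := by
  refine powSpan_le_multipliers (Submodule.subset_span
    ⟨Real.exp (-h), Real.exp_pos _, Real.exp_le_one_iff.2 (by linarith), ?_⟩)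
  ext t
  rw [cpow_def_of_ne_zero (by exact_mod_cast (Real.exp_pos _).ne'), ← ofReal_log
    (Real.exp_pos _).le, Real.log_exp]
  simp

theorem resolvent_mem_multipliers {h : ℝ} (h0 : 0 < h) (h1 : h ≤ 1) :
    (fun t ↦ h / (1 - cexp (-h * critLine t))) ∈ multipliers := by
  refine multipliers_of_tendsto (C := 3 * 2)
    (p := fun N ↦ (h : ℂ) • ∑ j ∈ Finset.range N, (fun t ↦ cexp (-h * critLine t)) ^ j)
    (fun N ↦ multipliers.smul_mem (sum_mem fun j _ ↦ pow_mem (exp_mem_multipliers h0.le) j) _)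
    (fun N t ↦ ?_) fun t ↦ ?_
  · have hlt : Real.exp (-(h / 2)) ≤ 1 := Real.exp_le_one_iff.2 (by linarith)
    have hne : cexp (-h * critLine t) ≠ 1 := fun h2 ↦ by
      have := le_norm_one_sub_exp h0 h1 t
      rw [h2] at this; norm_num at this; linarith
    simp only [Pi.smul_apply, Finset.sum_apply, Pi.pow_apply, smul_eq_mul]
    rw [geom_sum_eq hne, norm_mul, norm_div, norm_real, Real.norm_of_nonneg h0.le, ← mul_div_assoc,
      div_le_iff₀ (by rw [norm_pos_iff]; exact sub_ne_zero.2 hne), norm_sub_rev _ (1 : ℂ),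
      norm_sub_rev _ (1 : ℂ)]
    have h3 : ‖1 - cexp (-h * critLine t) ^ N‖ ≤ 2 := by
      refine (norm_sub_le _ _).trans ?_
      rw [norm_one, norm_pow, norm_exp_neg_mul_critLine]
      have := pow_le_one₀ (n := N) (Real.exp_pos (-(h / 2))).le hlt
      linarith
    have h4 := le_norm_one_sub_exp h0 h1 t
    nlinarith
  · have hlt : ‖cexp (-h * critLine t)‖ < 1 := by
      rw [norm_exp_neg_mul_critLine]; exact Real.exp_lt_one_iff.2 (by linarith)
    have := ((hasSum_geometric_of_norm_lt_one hlt).tendsto_sum_nat).const_mul (h : ℂ)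
    simpa [div_eq_mul_inv] using this

theorem inv_critLine_mem_multipliers : (fun t ↦ (critLine t)⁻¹) ∈ multipliers := by
  set h : ℕ → ℝ := fun n ↦ 1 / ((n : ℝ) + 1) with hh
  have h0 : ∀ n, 0 < h n := fun n ↦ by positivity
  have h1 : ∀ n, h n ≤ 1 := fun n ↦ by
    rw [hh]; simp only; rw [div_le_one (by positivity)]
    have : (0 : ℝ) ≤ n := n.cast_nonneg
    linarith
  refine multipliers_of_tendsto (C := 3) (fun n ↦ resolvent_mem_multipliers (h0 n) (h1 n))
    (fun n t ↦ ?_) fun t ↦ ?_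
  · have h2 := le_norm_one_sub_exp (h0 n) (h1 n) t
    have h3 := h0 n
    rw [norm_div, norm_real, Real.norm_of_nonneg (h0 n).le, div_le_iff₀ (by linarith)]
    linarith
  · have hd : HasDerivAt (fun z : ℂ ↦ 1 - cexp (-z * critLine t)) (critLine t) 0 := by
      have h4 := (((hasDerivAt_id (0 : ℂ)).neg.mul_const (critLine t)).cexp).const_sub 1
      simpa using h4
    have hlim : Tendsto (fun n ↦ (h n : ℂ)) atTop (𝓝[≠] 0) := by
      refine tendsto_nhdsWithin_iff.2 ⟨?_, Eventually.of_forall fun n ↦ ?_⟩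
      · have : Tendsto h atTop (𝓝 0) := tendsto_one_div_add_atTop_nhds_zero_nat
        simpa [Function.comp_def] using (continuous_ofReal.tendsto 0).comp this
      · simpa using (h0 n).ne'
    have h5 := ((hasDerivAt_iff_tendsto_slope.1 hd).comp hlim).inv₀ (critLine_ne_zero t)
    refine h5.congr fun n ↦ ?_
    simp [slope_def_field, div_eq_mul_inv, mul_comm]

/-- The Cayley transform of the critical line. -/
noncomputable def cayley (t : ℝ) : ℂ := 1 - (critLine t)⁻¹

theorem norm_cayley_le (t : ℝ) : ‖cayley t‖ ≤ 1 := by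
  have h0 := critLine_ne_zero t
  have h1 : cayley t = (critLine t - 1) / critLine t := by
    rw [cayley]; field_simp
  rw [h1, norm_div, div_le_one (norm_pos_iff.2 h0), ← sq_le_sq₀ (norm_nonneg _) (norm_nonneg _),
    Complex.sq_norm, Complex.sq_norm, normSq_apply, normSq_apply]
  simp only [sub_re, sub_im, one_re, one_im, critLine_re]
  norm_num

theorem cayley_mem_multipliers : cayley ∈ multipliers :=
  sub_mem (one_mem _) inv_critLine_mem_multipliers

theorem half_lt_re_inv_one_sub {z : ℂ} (hz : ‖z‖ < 1) :
    1 / 2 < ((1 - z)⁻¹).re := by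
  have h1 : z ≠ 1 := fun h ↦ by simp [h] at hz
  have hn : 0 < normSq (1 - z) := normSq_pos.2 (sub_ne_zero.2 h1.symm)
  rw [inv_re, lt_div_iff₀ hn, normSq_apply]
  have : ‖z‖ ^ 2 < 1 := pow_lt_one₀ (norm_nonneg _) hz two_ne_zero
  rw [Complex.sq_norm, normSq_apply] at this
  simp only [sub_re, sub_im, one_re, one_im]
  nlinarith

theorem comp_mul_cayley_mem_multipliers {Q : ℂ → ℂ} (hQ : DifferentiableOn ℂ Q (Metric.ball 0 1))
    {r : ℝ} (hr0 : 0 ≤ r) (hr : r < 1) : (fun t ↦ Q (r * cayley t)) ∈ multipliers := by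
  have hmem {z : ℂ} (hz : ‖z‖ ≤ 1) : (r : ℂ) * z ∈ Metric.ball (0 : ℂ) 1 := by
    rw [mem_ball_zero_iff, norm_mul, norm_real, Real.norm_of_nonneg hr0]
    exact (mul_le_of_le_one_right hr0 hz).trans_lt hr
  have hs {z : ℂ} (hz : ‖z‖ ≤ 1) := hasSum_taylorSeries_on_ball hQ (hmem hz)
  set a : ℕ → ℂ := fun n ↦ (n.factorial : ℂ)⁻¹ * (r : ℂ) ^ n * iteratedDeriv n Q 0 with ha
  have hs' {z : ℂ} (hz : ‖z‖ ≤ 1) : HasSum (fun n ↦ a n * z ^ n) (Q (r * z)) := by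
    refine (hs hz).congr_fun fun n ↦ ?_
    simp only [ha, sub_zero, smul_eq_mul, mul_pow]
    ring
  have hsum : Summable fun n ↦ ‖a n‖ := by
    have := (hs' (z := 1) (by simp)).summable.norm
    simpa using this
  refine multipliers_of_tendsto (C := ∑' n, ‖a n‖)
    (p := fun N ↦ ∑ n ∈ Finset.range N, a n • cayley ^ n)
    (fun N ↦ sum_mem fun n _ ↦ multipliers.smul_mem (pow_mem cayley_mem_multipliers n) _)
    (fun N t ↦ ?_) fun t ↦ ?_
  · rw [Finset.sum_apply]
    refine (norm_sum_le _ _).trans ((Finset.sum_le_sum fun n _ ↦ ?_).trans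
      (hsum.sum_le_tsum (Finset.range N) fun n _ ↦ norm_nonneg _))
    rw [Pi.smul_apply, Pi.pow_apply, norm_smul, norm_pow]
    exact mul_le_of_le_one_right (norm_nonneg _) (pow_le_one₀ (norm_nonneg _) (norm_cayley_le t))
  · simpa using (hs' (norm_cayley_le t)).tendsto_sum_nat

theorem mem_multipliers_of_bounded {p : ℂ → ℂ} {C : ℝ}
    (hd : DifferentiableOn ℂ p {s | 1 / 2 < s.re}) (hc : ContinuousOn p {s | 1 / 2 ≤ s.re})
    (hC : ∀ s : ℂ, 1 / 2 ≤ s.re → ‖p s‖ ≤ C) : (fun t ↦ p (critLine t)) ∈ multipliers := by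
  have hQ : DifferentiableOn ℂ (fun z ↦ p ((1 - z)⁻¹)) (Metric.ball 0 1) := by
    refine hd.comp (fun z hz ↦ ?_) fun z hz ↦ half_lt_re_inv_one_sub (by simpa using hz)
    have h1 : 1 - z ≠ 0 := fun h ↦ by
      rw [sub_eq_zero] at h; simp [← h] at hz
    exact ((differentiableAt_id.const_sub 1).inv h1).differentiableWithinAt
  set r : ℕ → ℝ := fun n ↦ 1 - 1 / ((n : ℝ) + 1) with hr
  have hr0 : ∀ n, 0 ≤ r n := fun n ↦ by
    rw [hr]; simp only [sub_nonneg]; rw [div_le_one (by positivity)]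
    have : (0 : ℝ) ≤ n := n.cast_nonneg
    linarith
  have hr1 : ∀ n, r n < 1 := fun n ↦ by
    have : 0 < 1 / ((n : ℝ) + 1) := by positivity
    simp only [hr]; linarith
  have hn : ∀ n t, ‖(r n : ℂ) * cayley t‖ < 1 := fun n t ↦ by
    rw [norm_mul, norm_real, Real.norm_of_nonneg (hr0 n)]
    exact (mul_le_of_le_one_right (hr0 n) (norm_cayley_le t)).trans_lt (hr1 n)
  refine multipliers_of_tendsto (C := C)
    (fun n ↦ comp_mul_cayley_mem_multipliers hQ (hr0 n) (hr1 n))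
    (fun n t ↦ hC _ (half_lt_re_inv_one_sub (hn n t)).le) fun t ↦ ?_
  have hne : 1 - cayley t ≠ 0 := by simp [cayley, critLine_ne_zero]
  have h1 : Tendsto (fun n ↦ (1 - (r n : ℂ) * cayley t)⁻¹) atTop (𝓝 (critLine t)) := by
    have h2 : Tendsto r atTop (𝓝 1) := by
      simpa [hr] using tendsto_one_div_add_atTop_nhds_zero_nat.const_sub (1 : ℝ)
    have h3 : Tendsto (fun n ↦ (r n : ℂ)) atTop (𝓝 1) := by
      simpa [Function.comp_def] using (continuous_ofReal.tendsto 1).comp h2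
    have h4 := ((h3.mul_const (cayley t)).const_sub 1).inv₀ (by simpa using hne)
    simpa [cayley] using h4
  refine (hc (critLine t) (by simp [critLine_re])).tendsto.comp
    (tendsto_nhdsWithin_iff.2 ⟨h1, Eventually.of_forall fun n ↦ ?_⟩)
  exact (half_lt_re_inv_one_sub (hn n t)).le

/-! ### Lower bounds for zero-free functions -/

theorem exists_log_on_ball {g : ℂ → ℂ} {R : ℝ} (hR : 0 < R)
    (hg : DifferentiableOn ℂ g (Metric.ball 0 R)) (h0 : ∀ z ∈ Metric.ball (0 : ℂ) R, g z ≠ 0)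
    (h1 : g 0 = 1) : ∃ L : ℂ → ℂ, DifferentiableOn ℂ L (Metric.ball 0 R) ∧ L 0 = 0 ∧
      ∀ z ∈ Metric.ball (0 : ℂ) R, cexp (L z) = g z := by
  have hd : DifferentiableOn ℂ (fun z ↦ deriv g z / g z) (Metric.ball 0 R) :=
    (hg.deriv Metric.isOpen_ball).div hg h0
  obtain ⟨L, hL0, hL⟩ := hd.isExactOn_ball.with_val_at 0 0
  have hLd : DifferentiableOn ℂ L (Metric.ball 0 R) := fun z hz ↦
    (hL z hz).differentiableAt.differentiableWithinAt
  refine ⟨L, hLd, hL0, fun z hz ↦ ?_⟩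
  have hq : ∀ z ∈ Metric.ball (0 : ℂ) R, HasDerivAt (fun z ↦ cexp (-L z) * g z) 0 z := by
    intro z hz
    have hgz := (hg.differentiableAt (Metric.isOpen_ball.mem_nhds hz)).hasDerivAt
    have := ((hL z hz).neg.cexp).mul hgz
    refine this.congr_deriv ?_
    rw [mul_assoc, neg_mul, div_mul_cancel₀ _ (h0 z hz)]
    ring
  have hc := Metric.isOpen_ball.is_const_of_deriv_eq_zero
    (convex_ball (0 : ℂ) R).isPreconnected
    (fun z hz ↦ (hq z hz).differentiableAt.differentiableWithinAt)
    (fun z hz ↦ (hq z hz).deriv) hz (Metric.mem_ball_self hR)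
  simp only [hL0, h1, neg_zero, Complex.exp_zero, mul_one] at hc
  rw [← mul_one (cexp (L z)), ← hc, ← mul_assoc, ← Complex.exp_add]
  simp

theorem exp_le_norm_of_zero_free {g : ℂ → ℂ} {R B : ℝ} (hR : 0 < R) (hB : 1 < B)
    (hg : DifferentiableOn ℂ g (Metric.ball 0 R)) (h0 : ∀ z ∈ Metric.ball (0 : ℂ) R, g z ≠ 0)
    (h1 : g 0 = 1) (hb : ∀ z ∈ Metric.ball (0 : ℂ) R, ‖g z‖ ≤ B) {z : ℂ}
    (hz : z ∈ Metric.ball (0 : ℂ) R) :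
    Real.exp (-(2 * Real.log B * ‖z‖ / (R - ‖z‖))) ≤ ‖g z‖ := by
  obtain ⟨L, hL, hL0, hexp⟩ := exists_log_on_ball hR hg h0 h1
  have hre : ∀ z ∈ Metric.ball (0 : ℂ) R, (L z).re ≤ Real.log B := fun z hz ↦ by
    rw [Real.le_log_iff_exp_le (by linarith), ← norm_exp, hexp z hz]
    exact hb z hz
  have := borelCaratheodory_zero (Real.log_pos hB) hL hre hR hz hL0
  rw [← hexp z hz, norm_exp, Real.exp_le_exp]
  exact (neg_le_neg this).trans (neg_le_of_abs_le (abs_re_le_norm (L z)))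

/-! ### Polynomial bounds for the zeta function -/

theorem norm_riemannZeta₁_le_sq {w : ℂ} (hw : 1 / 4 ≤ w.re) :
    ‖riemannZeta₁ w‖ ≤ 5 * (1 + ‖w‖) ^ 2 := by
  refine (norm_riemannZeta₁_le (by linarith)).trans ?_
  have h1 : ‖w - 1‖ ≤ ‖w‖ + 1 := (norm_sub_le _ _).trans (by simp)
  have h2 : ‖w‖ * ‖w - 1‖ / w.re ≤ ‖w‖ * (‖w‖ + 1) / (1 / 4) := by gcongr
  have := norm_nonneg w
  nlinarith

theorem exists_zeta_bounds : ∃ M : ℝ, 1 ≤ M ∧ ∀ c : ℂ, 2 ≤ c.re →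
    ‖riemannZeta c‖ ≤ M ∧ M⁻¹ ≤ ‖riemannZeta c‖ := by
  have key : ∀ f : ℕ → ℂ, (∀ n, ‖f n‖ ≤ ‖(1 : ℕ → ℂ) n‖) → ∀ c : ℂ, 2 ≤ c.re →
      ‖LSeries f c‖ ≤ ∑' n, ‖LSeries.term 1 2 n‖ := by
    intro f hf c hc
    have hs : LSeriesSummable 1 2 := LSeriesSummable_one_iff.2 (by simp)
    refine tsum_of_norm_bounded hs.norm.hasSum fun n ↦ ?_
    exact (LSeries.norm_term_le c (hf n)).trans
      (LSeries.norm_term_le_of_re_le_re _ (by simpa using hc) n)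
  set M := ∑' n, ‖LSeries.term 1 2 n‖ with hM
  have hz : ∀ c : ℂ, 2 ≤ c.re → ‖riemannZeta c‖ ≤ M := fun c hc ↦ by
    rw [← LSeries_one_eq_riemannZeta (by linarith)]
    exact key 1 (fun n ↦ le_rfl) c hc
  have hm : ∀ c : ℂ, 2 ≤ c.re → 1 ≤ ‖riemannZeta c‖ * M := fun c hc ↦ by
    have h1 := ArithmeticFunction.LSeries_zeta_mul_Lseries_moebius (s := c) (by linarith)
    rw [ArithmeticFunction.LSeries_zeta_eq_riemannZeta (by linarith)] at h1
    rw [← norm_one (α := ℂ), ← h1, norm_mul]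
    refine mul_le_mul_of_nonneg_left (key _ (fun n ↦ ?_) c hc) (norm_nonneg _)
    simp only [Pi.one_apply, norm_one]
    norm_cast
    exact ArithmeticFunction.abs_moebius_le_one
  have hM0 : 0 ≤ M := (norm_nonneg _).trans (hz 2 (by simp))
  have hM1 : 1 ≤ M := by
    have h1 := hm 2 (by simp)
    have h2 := hz 2 (by simp)
    nlinarith
  refine ⟨M, hM1, fun c hc ↦ ⟨hz c hc, ?_⟩⟩
  rw [inv_le_iff_one_le_mul₀ (by linarith)]
  exact hm c hc

theorem riemannZeta₁_eq_mul {s : ℂ} (hs : s ≠ 1) :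
    riemannZeta₁ s = (s - 1) * riemannZeta s := by
  rw [riemannZeta_eq_inv_sub_mul hs, mul_inv_cancel_left₀ (sub_ne_zero.2 hs)]

theorem riemannZeta₁_ne_zero (hRH : RiemannHypothesis) {s : ℂ} (hs : 1 / 2 < s.re) :
    riemannZeta₁ s ≠ 0 := by
  rcases eq_or_ne s 1 with rfl | h1
  · rw [riemannZeta₁_one]; exact one_ne_zero
  · rw [riemannZeta₁_eq_mul h1]
    refine mul_ne_zero (sub_ne_zero.2 h1) fun h ↦ hs.ne' (hRH s h ?_ h1)
    rintro ⟨n, rfl⟩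
    have : (0 : ℝ) ≤ n := n.cast_nonneg
    simp at hs
    linarith

theorem exists_inv_riemannZeta₁_le (hRH : RiemannHypothesis) {η : ℝ} (hη : 0 < η) (hη1 : η ≤ 1) :
    ∃ (C : ℝ) (N : ℕ), 0 < C ∧ ∀ w : ℂ, 1 / 2 + η ≤ w.re →
      ‖(riemannZeta₁ w)⁻¹‖ ≤ C * (1 + ‖w‖) ^ N := by
  obtain ⟨M, hM1, hM⟩ := exists_zeta_bounds
  obtain ⟨k, hk⟩ := exists_nat_ge (6 / η)
  refine ⟨M * (125 * M) ^ k, 2 * k, by positivity, fun w hw ↦ ?_⟩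
  set c : ℂ := w + 3 / 2 with hc
  have hcre : c.re = w.re + 3 / 2 := by simp [hc]
  have hc2 : 2 ≤ c.re := by linarith
  have hc1 : c ≠ 1 := fun h ↦ by rw [h] at hc2; norm_num at hc2
  have hZc : M⁻¹ ≤ ‖riemannZeta₁ c‖ := by
    rw [riemannZeta₁_eq_mul hc1, norm_mul]
    have h1 : 1 ≤ ‖c - 1‖ := by
      refine le_trans ?_ (re_le_norm (c - 1))
      simp; linarith
    nlinarith [(hM c hc2).2, norm_nonneg (riemannZeta c)]
  have hMpos : 0 < M := by linarith
  have hZc0 : 0 < ‖riemannZeta₁ c‖ := (inv_pos.2 hMpos).trans_le hZc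
  set R : ℝ := 3 / 2 + η / 2 with hR
  set B : ℝ := 125 * M * (1 + ‖w‖) ^ 2 with hB
  have hwn := norm_nonneg w
  have hB1 : 1 < B := by
    have : 1 ≤ (1 + ‖w‖) ^ 2 := one_le_pow₀ (by linarith)
    nlinarith
  have hlarge : ∀ z ∈ Metric.ball (0 : ℂ) R, 1 / 2 < (c + z).re := fun z hz ↦ by
    rw [mem_ball_zero_iff] at hz
    have := neg_le_of_abs_le (abs_re_le_norm z)
    rw [add_re, hcre]
    linarith
  have hb : ∀ z ∈ Metric.ball (0 : ℂ) R, ‖riemannZeta₁ (c + z) / riemannZeta₁ c‖ ≤ B := by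
    intro z hz
    have h1 := norm_riemannZeta₁_le_sq (w := c + z) (by linarith [hlarge z hz])
    have h2 : 1 + ‖c + z‖ ≤ 5 * (1 + ‖w‖) := by
      rw [mem_ball_zero_iff] at hz
      have h3 : ‖c‖ ≤ ‖w‖ + 3 / 2 := (norm_add_le _ _).trans (by norm_num)
      have := norm_add_le c z
      linarith
    have h4 : ‖riemannZeta₁ (c + z)‖ ≤ 125 * (1 + ‖w‖) ^ 2 := by
      refine h1.trans ?_
      calc 5 * (1 + ‖c + z‖) ^ 2 ≤ 5 * (5 * (1 + ‖w‖)) ^ 2 := by gcongr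
        _ = 125 * (1 + ‖w‖) ^ 2 := by ring
    rw [norm_div, div_le_iff₀ hZc0]
    calc ‖riemannZeta₁ (c + z)‖ ≤ 125 * (1 + ‖w‖) ^ 2 := h4
      _ = B * M⁻¹ := by rw [hB]; field_simp
      _ ≤ B * ‖riemannZeta₁ c‖ := by gcongr
  have hlow := exp_le_norm_of_zero_free (g := fun z ↦ riemannZeta₁ (c + z) / riemannZeta₁ c)
    (R := R) (by positivity) hB1
    (((differentiable_riemannZeta₁.comp (differentiable_id.const_add c)).div_const
      _).differentiableOn)
    (fun z hz ↦ div_ne_zero (riemannZeta₁_ne_zero hRH (hlarge z hz)) (norm_pos_iff.1 hZc0))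
    (by simp [norm_pos_iff.1 hZc0]) hb (z := -(3 / 2))
    (by rw [mem_ball_zero_iff]; norm_num; linarith)
  have hnorm : ‖(-(3 / 2) : ℂ)‖ = 3 / 2 := by norm_num
  have hcw : c + -(3 / 2) = w := by rw [hc]; ring
  have hexp : 2 * Real.log B * (3 / 2) / (R - 3 / 2) = 6 / η * Real.log B := by
    rw [hR, add_sub_cancel_left]; field_simp; ring
  simp only [hnorm, hcw, hexp, norm_div] at hlow
  have hlogB := Real.log_pos hB1
  have hlow2 : (B ^ k)⁻¹ ≤ Real.exp (-(6 / η * Real.log B)) := by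
    rw [Real.exp_neg]
    refine inv_anti₀ (Real.exp_pos _) ?_
    rw [← Real.rpow_natCast, Real.rpow_def_of_pos (by linarith), Real.exp_le_exp, mul_comm]
    gcongr
  have hfin := hlow2.trans hlow
  rw [le_div_iff₀ hZc0] at hfin
  have hBk : 0 < B ^ k := by positivity
  have h5 : (B ^ k)⁻¹ * M⁻¹ ≤ ‖riemannZeta₁ w‖ :=
    (mul_le_mul_of_nonneg_left hZc (by positivity)).trans hfin
  rw [norm_inv]
  refine (inv_anti₀ (by positivity) h5).trans (le_of_eq ?_)
  rw [hB, mul_inv, inv_inv, inv_inv, mul_pow, ← pow_mul]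
  ring

/-! ### Convexity bounds in vertical strips -/

theorem closure_preimage_re_Ioo {a b : ℝ} (hab : a < b) :
    closure (re ⁻¹' Ioo a b) = re ⁻¹' Icc a b := by
  rw [← closure_Ioo hab.ne, closure_preimage_re]

theorem one_add_abs_rpow_le {κ : ℝ} (hκ : 0 ≤ κ) (hκ1 : κ ≤ 1) (t T : ℝ) :
    (1 + |t|) ^ κ ≤ (1 + |T|) ^ κ * (1 + |t - T|) := by
  have h : 1 + |t| ≤ (1 + |T|) * (1 + |t - T|) := by
    have := abs_sub_abs_le_abs_sub t T
    nlinarith [mul_nonneg (abs_nonneg T) (abs_nonneg (t - T))]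
  calc (1 + |t|) ^ κ ≤ ((1 + |T|) * (1 + |t - T|)) ^ κ := by gcongr
    _ = (1 + |T|) ^ κ * (1 + |t - T|) ^ κ := Real.mul_rpow (by positivity) (by positivity)
    _ ≤ (1 + |T|) ^ κ * (1 + |t - T|) := by
        gcongr
        exact Real.rpow_le_self_of_one_le (by linarith [abs_nonneg (t - T)]) hκ1

/-- A polynomial version of the three lines theorem. -/
theorem norm_le_of_vertical_strip {a b κ₀ κ₁ A D B : ℝ} {f : ℂ → ℂ} (hab : a < b)
    (hab3 : b - a ≤ 3) (hκ₀ : 0 ≤ κ₀) (hκ₀' : κ₀ ≤ 1) (hκ₁ : 0 ≤ κ₁) (hκ₁' : κ₁ ≤ 1) (hB : 0 ≤ B)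
    (hf : DiffContOnCl ℂ f (re ⁻¹' Ioo a b))
    (hgrowth : ∀ z : ℂ, a < z.re → z.re < b → ‖f z‖ ≤ D * Real.exp (B * |z.im|))
    (ha : ∀ z : ℂ, z.re = a → ‖f z‖ ≤ A * (1 + |z.im|) ^ κ₀)
    (hb : ∀ z : ℂ, z.re = b → ‖f z‖ ≤ A * (1 + |z.im|) ^ κ₁)
    {s : ℂ} (hsa : a ≤ s.re) (hsb : s.re ≤ b) :
    ‖f s‖ ≤ 2 * A * (b - a + 1) *
      (1 + |s.im|) ^ (κ₀ + (κ₁ - κ₀) * ((s.re - a) / (b - a))) := by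
  set T := s.im with hT
  set l := Real.log (1 + |T|) with hl
  have hT1 : (1 : ℝ) ≤ 1 + |T| := by linarith [abs_nonneg T]
  have hl0 : 0 ≤ l := Real.log_nonneg hT1
  have hA : 0 ≤ A := by
    have := (norm_nonneg _).trans (ha a (by simp))
    simpa using this
  set κ : ℝ → ℝ := fun σ ↦ κ₀ + (κ₁ - κ₀) * ((σ - a) / (b - a)) with hκ
  have hκa : κ a = κ₀ := by simp [hκ]
  have hκb : κ b = κ₁ := by simp [hκ, div_self (sub_pos.2 hab).ne']
  have hκnn : ∀ σ, a ≤ σ → σ ≤ b → 0 ≤ κ σ := fun σ h1 h2 ↦ by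
    have h3 : (σ - a) / (b - a) ≤ 1 := (div_le_one (by linarith)).2 (by linarith)
    have h4 : 0 ≤ (σ - a) / (b - a) := div_nonneg (by linarith) (by linarith)
    simp only [hκ]
    nlinarith
  set e : ℂ → ℂ := fun z ↦ cexp (-((κ₀ : ℂ) + (κ₁ - κ₀) * ((z - a) / (b - a))) * l) with he
  have hen : ∀ z : ℂ, ‖e z‖ = (1 + |T|) ^ (-κ z.re) := fun z ↦ by
    rw [he, norm_exp, Real.rpow_def_of_pos (by linarith), ← hl, mul_comm l]
    congr 1
    have : (-((κ₀ : ℂ) + (κ₁ - κ₀) * ((z - a) / (b - a))) * l).re =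
        -((κ₀ : ℂ) + ((κ₁ - κ₀ : ℝ) : ℂ) * ((z - a) / ((b - a : ℝ) : ℂ))).re * l := by
      push_cast
      rw [re_mul_ofReal, neg_re]
    rw [this, add_re, re_ofReal_mul, div_ofReal_re]
    simp [hκ]
  set d : ℂ → ℂ := fun z ↦ z - T * I - a + 1 with hd
  have hdre : ∀ z : ℂ, (d z).re = z.re - a + 1 := fun z ↦ by simp [hd]
  have hdim : ∀ z : ℂ, (d z).im = z.im - T := fun z ↦ by simp [hd]
  have hd1 : ∀ z : ℂ, a ≤ z.re → 1 ≤ ‖d z‖ := fun z hz ↦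
    le_trans (by rw [hdre]; linarith) (re_le_norm (d z))
  have hd2 : ∀ z : ℂ, a ≤ z.re → 1 + |z.im - T| ≤ 2 * ‖d z‖ := fun z hz ↦ by
    have := abs_im_le_norm (d z)
    rw [hdim] at this
    linarith [hd1 z hz]
  have hcl := closure_preimage_re_Ioo hab
  set G : ℂ → ℂ := fun z ↦ (d z)⁻¹ * e z * f z with hG
  have hGd : DiffContOnCl ℂ G (re ⁻¹' Ioo a b) := by
    have h1 : DiffContOnCl ℂ d (re ⁻¹' Ioo a b) :=
      Differentiable.diffContOnCl (by simp only [hd]; fun_prop)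
    have h2 : DiffContOnCl ℂ e (re ⁻¹' Ioo a b) :=
      Differentiable.diffContOnCl (by simp only [he]; fun_prop)
    have h3 := h1.inv (fun z hz h0 ↦ by
      rw [hcl] at hz
      have := hd1 z hz.1
      rw [h0, norm_zero] at this
      linarith)
    exact (h3.smul h2).smul hf
  have hedge : ∀ z : ℂ, a ≤ z.re → 0 ≤ κ z.re → κ z.re ≤ 1 →
      ‖f z‖ ≤ A * (1 + |z.im|) ^ κ z.re → ‖G z‖ ≤ 2 * A := fun z hz h0 h1 h ↦ by
    have hdz : 0 < ‖d z‖ := by linarith [hd1 z hz]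
    rw [hG, norm_mul, norm_mul, norm_inv, hen, Real.rpow_neg (by linarith)]
    have h2 : ‖f z‖ ≤ A * ((1 + |T|) ^ κ z.re * (2 * ‖d z‖)) :=
      h.trans (mul_le_mul_of_nonneg_left ((one_add_abs_rpow_le h0 h1 _ T).trans
        (mul_le_mul_of_nonneg_left (hd2 z hz) (by positivity))) hA)
    refine (mul_le_mul_of_nonneg_left h2 (by positivity)).trans (le_of_eq ?_)
    have : (1 + |T|) ^ κ z.re ≠ 0 := by positivity
    field_simp
  have hGs : ‖G s‖ ≤ 2 * A := by
    refine PhragmenLindelof.vertical_strip (a := a) (b := b) hGd ?_ ?_ ?_ hsa hsb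
    · refine ⟨1, ?_, B, ?_⟩
      · rw [lt_div_iff₀ (by linarith)]
        linarith [Real.pi_gt_three]
      · refine Asymptotics.IsBigO.of_bound |D| ?_
        rw [eventually_inf_principal]
        refine Eventually.of_forall fun z hz ↦ ?_
        have hdz : 0 < ‖d z‖ := by linarith [hd1 z hz.1.le]
        rw [hG, norm_mul, norm_mul, norm_inv, hen]
        have h1 : ‖d z‖⁻¹ ≤ 1 := inv_le_one_of_one_le₀ (hd1 z hz.1.le)
        have h2 : (1 + |T|) ^ (-κ z.re) ≤ 1 :=
          Real.rpow_le_one_of_one_le_of_nonpos hT1 (neg_nonpos.2 (hκnn _ hz.1.le hz.2.le))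
        have h3 : ‖f z‖ ≤ |D| * Real.exp (B * Real.exp (1 * |z.im|)) := by
          refine (hgrowth z hz.1 hz.2).trans ?_
          gcongr
          · exact le_abs_self D
          · rw [one_mul]
            linarith [Real.add_one_le_exp |z.im|]
        rw [Real.norm_of_nonneg (Real.exp_pos _).le]
        calc ‖d z‖⁻¹ * (1 + |T|) ^ (-κ z.re) * ‖f z‖ ≤ 1 * 1 * ‖f z‖ := by gcongr
          _ ≤ _ := by rw [one_mul, one_mul]; exact h3
    · intro z hz
      exact hedge z hz.ge (by rw [hz, hκa]; exact hκ₀) (by rw [hz, hκa]; exact hκ₀')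
        (by rw [hz, hκa]; exact ha z hz)
    · intro z hz
      exact hedge z (hz.symm ▸ hab.le) (by rw [hz, hκb]; exact hκ₁) (by rw [hz, hκb]; exact hκ₁')
        (by rw [hz, hκb]; exact hb z hz)
  have hds : ‖d s‖ ≤ b - a + 1 := by
    have : d s = ((s.re - a + 1 : ℝ) : ℂ) := by
      apply Complex.ext
      · rw [hdre, ofReal_re]
      · rw [hdim, ofReal_im, hT, sub_self]
    rw [this, norm_real, Real.norm_of_nonneg (by linarith)]
    linarith
  have hdz : 0 < ‖d s‖ := by linarith [hd1 s hsa]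
  have hfs : ‖f s‖ = ‖G s‖ * ‖d s‖ * (1 + |T|) ^ κ s.re := by
    rw [hG, norm_mul, norm_mul, norm_inv, hen, Real.rpow_neg (by linarith)]
    have : (1 + |T|) ^ κ s.re ≠ 0 := by positivity
    field_simp
  rw [hfs]
  change _ ≤ 2 * A * (b - a + 1) * (1 + |T|) ^ κ s.re
  gcongr

/-! ### The Gamma factor of the functional equation -/

/-- The factor `Γ(z) cos(π z / 2)` of the functional equation. -/
noncomputable def gammaCos (z : ℂ) : ℂ := Gamma z * cos (Real.pi * z / 2)

theorem norm_cos_le_exp (w : ℂ) : ‖cos w‖ ≤ Real.exp |w.im| := by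
  have h : ‖cexp (w * I) + cexp (-w * I)‖ ≤ Real.exp |w.im| + Real.exp |w.im| := by
    refine (norm_add_le _ _).trans (add_le_add ?_ ?_) <;> rw [norm_exp, Real.exp_le_exp]
    · simpa using neg_le_abs w.im
    · simpa using le_abs_self w.im
  rw [cos, norm_div, show ‖(2 : ℂ)‖ = 2 by simp]
  linarith

theorem exists_norm_Gamma_le : ∃ D : ℝ, ∀ z : ℂ, 1 / 2 ≤ z.re → z.re ≤ 1 → ‖Gamma z‖ ≤ D := by
  have hc : ContinuousOn Real.Gamma (Icc (1 / 2) 1) := fun x hx ↦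
    (Real.differentiableAt_Gamma fun m h ↦ by
      have : (0 : ℝ) ≤ m := m.cast_nonneg
      linarith [hx.1]).continuousAt.continuousWithinAt
  obtain ⟨D, hD⟩ := isCompact_Icc.exists_bound_of_continuousOn hc
  refine ⟨D, fun z h1 h2 ↦ ?_⟩
  have hz : 0 < z.re := by linarith
  refine le_trans ?_ ((le_abs_self _).trans (hD z.re ⟨h1, h2⟩))
  rw [Gamma_eq_integral hz, GammaIntegral, Real.Gamma_eq_integral hz]
  refine (norm_integral_le_integral_norm _).trans
    (setIntegral_mono_on (GammaIntegral_convergent hz).norm (Real.GammaIntegral_convergent hz)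
      measurableSet_Ioi fun x hx ↦ ?_)
  rw [norm_mul, norm_real, Real.norm_of_nonneg (Real.exp_pos _).le,
    norm_cpow_eq_rpow_re_of_pos hx]
  simp

theorem differentiableAt_gammaCos {z : ℂ} (hz : 0 < z.re) : DifferentiableAt ℂ gammaCos z := by
  have h : DifferentiableAt ℂ Gamma z := differentiableAt_Gamma z fun m h ↦ by
    have : (0 : ℝ) ≤ m := m.cast_nonneg
    rw [h] at hz
    simp at hz
    linarith
  unfold gammaCos
  fun_prop

theorem norm_gammaCos_sq_of_re_half {z : ℂ} (hz : z.re = 1 / 2) :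
    ‖gammaCos z‖ ^ 2 ≤ Real.pi / 2 := by
  have hconj : 1 - z = (starRingEnd ℂ) z := by
    apply Complex.ext
    · simp [hz]; norm_num
    · simp
  have h1 := Gamma_mul_Gamma_one_sub z
  rw [hconj, Gamma_conj, mul_conj] at h1
  set w := Real.pi * z / 2 with hw
  have hcs : ‖cos w‖ = ‖sin w‖ := by
    have h2 : Real.pi / 2 - w = (starRingEnd ℂ) w := by
      rw [hw, map_div₀, map_mul, ← hconj, conj_ofReal, map_ofNat]
      ring
    rw [← Complex.sin_pi_div_two_sub, h2, sin_conj, norm_conj]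
  have h3 : ‖Gamma z‖ ^ 2 = Real.pi / (2 * ‖sin w‖ * ‖cos w‖) := by
    have h4 := congrArg norm h1
    have h5 : (Real.pi : ℂ) * z = 2 * w := by rw [hw]; ring
    rw [h5, sin_two_mul, norm_div, norm_mul, norm_mul, norm_real, norm_real, normSq_eq_norm_sq,
      Real.norm_of_nonneg (by positivity), Real.norm_of_nonneg Real.pi_pos.le] at h4
    simpa using h4
  rw [gammaCos, norm_mul, mul_pow, h3, hcs]
  rcases eq_or_ne ‖sin w‖ 0 with h | h
  · rw [h]; simp; positivity
  · apply le_of_eq; field_simp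

theorem norm_gammaCos_sq_of_re_one {z : ℂ} (hz : z.re = 1) :
    ‖gammaCos z‖ ^ 2 ≤ Real.pi / 2 * |z.im| := by
  rcases eq_or_ne z.im 0 with h0 | h0
  · have : z = 1 := Complex.ext (by simp [hz]) (by simp [h0])
    simp [this, gammaCos]
  set y : ℝ := Real.pi * z.im / 2 with hy
  have hzI : z = z.im * I + 1 := by
    apply Complex.ext <;> simp [hz]
  have hconj : 1 - z.im * I = (starRingEnd ℂ) z := by
    apply Complex.ext
    · simp [hz]
    · simp
  have hne : (z.im * I : ℂ) ≠ 0 := mul_ne_zero (ofReal_ne_zero.2 h0) I_ne_zero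
  have h1 := Gamma_mul_Gamma_one_sub (z.im * I)
  have h2 := Gamma_add_one _ hne
  rw [← hzI] at h2
  rw [hconj, Gamma_conj] at h1
  have h3 : ‖Gamma z‖ ^ 2 = |z.im| * (Real.pi / (2 * ‖sin (y * I)‖ * ‖cos (y * I)‖)) := by
    have h5 : (Real.pi : ℂ) * (z.im * I) = 2 * (y * I) := by rw [hy]; push_cast; ring
    have h4 := congrArg norm h1
    rw [h5, sin_two_mul, norm_div, norm_mul, norm_mul, norm_mul, norm_conj, norm_real,
      Real.norm_of_nonneg Real.pi_pos.le] at h4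
    have h6 : ‖Gamma z‖ = |z.im| * ‖Gamma (z.im * I)‖ := by
      rw [h2, norm_mul, norm_mul, norm_real, norm_I, mul_one, Real.norm_eq_abs]
    rw [show ‖(2 : ℂ)‖ = 2 by simp] at h4
    rw [← h4, sq]
    nth_rewrite 1 [h6]
    ring
  have h7 : ‖cos (Real.pi * z / 2)‖ = ‖sin (y * I)‖ := by
    have : Real.pi * z / 2 = Real.pi / 2 + y * I := by
      nth_rewrite 1 [hzI]; rw [hy]; push_cast; ring
    rw [this, add_comm, Complex.cos_add_pi_div_two, norm_neg]
  have hsc : ‖sin (y * I)‖ ≤ ‖cos (y * I)‖ := by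
    rw [sin_mul_I, cos_mul_I, norm_mul, norm_I, mul_one, ← ofReal_sinh, ← ofReal_cosh, norm_real,
      norm_real, Real.norm_eq_abs, Real.norm_eq_abs]
    apply sq_le_sq.1
    rw [Real.cosh_sq]
    linarith
  rw [gammaCos, norm_mul, mul_pow, h3, h7]
  rcases (norm_nonneg (sin (y * I))).eq_or_lt with h | h
  · rw [← h]; simp; positivity
  · have hc := h.trans_le hsc
    have : |z.im| * (Real.pi / (2 * ‖sin (y * I)‖ * ‖cos (y * I)‖)) * ‖sin (y * I)‖ ^ 2 =
        Real.pi / 2 * |z.im| * (‖sin (y * I)‖ / ‖cos (y * I)‖) := by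
      field_simp
    rw [this]
    exact mul_le_of_le_one_right (by positivity) ((div_le_one hc).2 hsc)

theorem norm_gammaCos_le {z : ℂ} (h1 : 1 / 2 ≤ z.re) (h2 : z.re ≤ 1) :
    ‖gammaCos z‖ ≤ 6 * (1 + |z.im|) ^ (z.re - 1 / 2) := by
  obtain ⟨D, hD⟩ := exists_norm_Gamma_le
  have := norm_le_of_vertical_strip (a := 1 / 2) (b := 1) (κ₀ := 0) (κ₁ := 1 / 2) (A := 2) (D := D)
    (B := Real.pi / 2) (f := gammaCos) (s := z) (by norm_num) (by norm_num) le_rfl zero_le_one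
    (by norm_num) (by norm_num) (by positivity) ?_ ?_ ?_ ?_ h1 h2
  · convert this using 2
    · norm_num
    · ring_nf
  · have hcl := closure_preimage_re_Ioo (show (1 / 2 : ℝ) < 1 by norm_num)
    refine DifferentiableOn.diffContOnCl fun w hw ↦ ?_
    rw [hcl] at hw
    exact (differentiableAt_gammaCos (by linarith [hw.1])).differentiableWithinAt
  · intro w hw1 hw2
    rw [gammaCos, norm_mul]
    have h3 := norm_cos_le_exp (Real.pi * w / 2)
    have h4 : |(Real.pi * w / 2 : ℂ).im| = Real.pi / 2 * |w.im| := by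
      have : (Real.pi * w / 2 : ℂ) = ((Real.pi / 2 : ℝ) : ℂ) * w := by push_cast; ring
      rw [this, im_ofReal_mul, abs_mul, abs_of_pos (by positivity)]
    rw [h4] at h3
    gcongr
    exacts [(norm_nonneg _).trans (hD w hw1.le hw2.le), hD w hw1.le hw2.le]
  · intro w hw
    have := norm_gammaCos_sq_of_re_half hw
    rw [Real.rpow_zero, mul_one]
    nlinarith [Real.pi_lt_four, norm_nonneg (gammaCos w)]
  · intro w hw
    have h3 := norm_gammaCos_sq_of_re_one hw
    refine le_of_sq_le_sq ?_ (by positivity)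
    rw [mul_pow, ← Real.sqrt_eq_rpow, Real.sq_sqrt (by positivity)]
    nlinarith [Real.pi_lt_four, abs_nonneg w.im]

/-! ### Ratios of zeta values near the critical line -/

theorem norm_riemannZeta₁_le_reflected {s : ℂ} {δ : ℝ} (hδ : 0 < δ) (hδ' : δ ≤ 1 / 8)
    (hs : s.re = 1 / 2 - δ) :
    ‖riemannZeta₁ s‖ ≤ 36 * (1 + |s.im|) ^ (1 / 4 : ℝ) * ‖riemannZeta₁ (s + (2 * δ : ℝ))‖ := by
  set w := 1 - s with hw
  have hwre : w.re = 1 / 2 + δ := by simp [hw, hs]; ring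
  have hwim : |w.im| = |s.im| := by simp [hw]
  set s' := s + (2 * δ : ℝ) with hs'
  have hs're : s'.re = 1 / 2 + δ := by rw [hs', add_re, ofReal_re, hs]; ring
  have hconj : w = (starRingEnd ℂ) s' := by
    apply Complex.ext
    · rw [conj_re, hwre, hs're]
    · simp [hw, hs']
  have hw0 : ∀ n : ℕ, w ≠ -n := fun n h ↦ by
    have : (0 : ℝ) ≤ n := n.cast_nonneg
    have h2 := congrArg re h
    rw [hwre] at h2
    simp at h2
    linarith
  have hw1 : w ≠ 1 := fun h ↦ by rw [h, one_re] at hwre; linarith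
  have hs1 : s ≠ 1 := fun h ↦ by rw [h, one_re] at hs; linarith
  have hs'1 : s' ≠ 1 := fun h ↦ by rw [h, one_re] at hs're; linarith
  have hfe := riemannZeta_one_sub hw0 hw1
  have h1s : 1 - w = s := by rw [hw]; ring
  rw [h1s] at hfe
  have hz : ‖riemannZeta w‖ = ‖riemannZeta s'‖ := by rw [hconj, riemannZeta_conj, norm_conj]
  have hpi : ‖(2 * Real.pi : ℂ) ^ (-w)‖ ≤ 1 := by
    have : (2 * Real.pi : ℂ) = ((2 * Real.pi : ℝ) : ℂ) := by push_cast; rfl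
    rw [this, norm_cpow_eq_rpow_re_of_pos (by positivity), neg_re]
    exact Real.rpow_le_one_of_one_le_of_nonpos (by linarith [Real.pi_gt_three]) (by linarith)
  have hg : ‖gammaCos w‖ ≤ 6 * (1 + |s.im|) ^ (1 / 4 : ℝ) := by
    refine (norm_gammaCos_le (by linarith) (by linarith)).trans ?_
    rw [hwim]
    gcongr
    · linarith [abs_nonneg s.im]
    · linarith
  have hζ : ‖riemannZeta s‖ ≤ 12 * (1 + |s.im|) ^ (1 / 4 : ℝ) * ‖riemannZeta s'‖ := by
    rw [mul_assoc _ (Gamma w)] at hfe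
    change _ = _ * gammaCos w * _ at hfe
    rw [hfe, norm_mul, norm_mul, norm_mul, hz, show ‖(2 : ℂ)‖ = 2 by simp]
    refine mul_le_mul_of_nonneg_right ?_ (norm_nonneg _)
    calc 2 * ‖(2 * Real.pi : ℂ) ^ (-w)‖ * ‖gammaCos w‖
        ≤ 2 * 1 * (6 * (1 + |s.im|) ^ (1 / 4 : ℝ)) := by gcongr
      _ = 12 * (1 + |s.im|) ^ (1 / 4 : ℝ) := by ring
  have hn : ‖s - 1‖ ≤ 3 * ‖s' - 1‖ := by
    have h2 : 3 / 8 ≤ ‖s' - 1‖ := by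
      refine le_trans ?_ (abs_re_le_norm _)
      rw [sub_re, hs're, one_re, abs_of_neg (by linarith)]
      linarith
    have h3 : s - 1 = (s' - 1) - (2 * δ : ℝ) := by rw [hs']; ring
    have h4 : ‖s - 1‖ ≤ ‖s' - 1‖ + 2 * δ := by
      rw [h3]
      refine (norm_sub_le _ _).trans ?_
      rw [norm_real, Real.norm_of_nonneg (by linarith)]
    linarith
  rw [riemannZeta₁_eq_mul hs1, riemannZeta₁_eq_mul hs'1, norm_mul, norm_mul]
  calc ‖s - 1‖ * ‖riemannZeta s‖
      ≤ (3 * ‖s' - 1‖) * (12 * (1 + |s.im|) ^ (1 / 4 : ℝ) * ‖riemannZeta s'‖) := by gcongr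
    _ = _ := by ring

/-- Under the Riemann Hypothesis, shifting the argument to the right of the critical line
does not decrease `(s - 1) ζ(s)` too much, uniformly in the shift. -/
theorem exists_norm_ratio_le (hRH : RiemannHypothesis) : ∃ C : ℝ, 0 < C ∧
    ∀ ε : ℝ, 0 < ε → ε ≤ 1 / 4 → ∀ s : ℂ, s.re = 1 / 2 →
      ‖riemannZeta₁ s / riemannZeta₁ (s + ε)‖ ≤ C * (1 + |s.im|) ^ (1 / 4 : ℝ) := by
  obtain ⟨M, hM1, hM⟩ := exists_zeta_bounds
  refine ⟨2 * (36 * M ^ 2) * 3, by positivity, fun ε hε hε' s hs ↦ ?_⟩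
  obtain ⟨C, N, hC, hN⟩ := exists_inv_riemannZeta₁_le hRH (η := ε / 2) (by positivity)
    (by linarith)
  have hne : ∀ z : ℂ, 1 / 2 - ε / 2 ≤ z.re → riemannZeta₁ (z + ε) ≠ 0 := fun z hz ↦
    riemannZeta₁_ne_zero hRH (by rw [add_re, ofReal_re]; linarith)
  have := norm_le_of_vertical_strip (a := 1 / 2 - ε / 2) (b := 2) (κ₀ := 1 / 4) (κ₁ := 1 / 4)
    (A := 36 * M ^ 2) (D := 5 * C * 2 ^ N * 3 ^ (2 + N)) (B := (2 + N : ℕ))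
    (f := fun z ↦ riemannZeta₁ z / riemannZeta₁ (z + ε)) (s := s) (by linarith) (by linarith)
    (by norm_num) (by norm_num) (by norm_num) (by norm_num) (by positivity) ?_ ?_ ?_ ?_
    (by linarith) (by linarith)
  · rw [sub_self, zero_mul, add_zero] at this
    refine this.trans ?_
    gcongr
    linarith
  · have hcl := closure_preimage_re_Ioo (show 1 / 2 - ε / 2 < (2 : ℝ) by linarith)
    refine DifferentiableOn.diffContOnCl fun w hw ↦ ?_
    rw [hcl] at hw
    exact (differentiable_riemannZeta₁.differentiableAt.div
      (differentiable_riemannZeta₁.comp (differentiable_id.add_const _)).differentiableAt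
      (hne w hw.1)).differentiableWithinAt
  · intro z h1 h2
    have hz : 1 + ‖z‖ ≤ 3 * Real.exp |z.im| := by
      have h3 := norm_le_abs_re_add_abs_im z
      rw [abs_of_pos (show 0 < z.re by linarith)] at h3
      linarith [Real.add_one_le_exp |z.im|, abs_nonneg z.im]
    have hz2 : 1 + ‖z + ε‖ ≤ 2 * (3 * Real.exp |z.im|) := by
      have h3 := norm_add_le z (ε : ℂ)
      rw [norm_real, Real.norm_of_nonneg hε.le] at h3
      linarith [norm_nonneg z]
    rw [div_eq_mul_inv, norm_mul]
    calc ‖riemannZeta₁ z‖ * ‖(riemannZeta₁ (z + ε))⁻¹‖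
        ≤ (5 * (1 + ‖z‖) ^ 2) * (C * (1 + ‖z + ε‖) ^ N) := by
          gcongr
          · exact norm_riemannZeta₁_le_sq (by linarith)
          · exact hN _ (by rw [add_re, ofReal_re]; linarith)
      _ ≤ (5 * (3 * Real.exp |z.im|) ^ 2) * (C * (2 * (3 * Real.exp |z.im|)) ^ N) := by gcongr
      _ = _ := by
          rw [Real.exp_nat_mul, mul_pow 2]
          ring
  · intro z hz
    have h := norm_riemannZeta₁_le_reflected (s := z) (δ := ε / 2) (by linarith) (by linarith) hz
    rw [mul_div_cancel₀ ε two_ne_zero] at h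
    rw [norm_div, div_le_iff₀ (norm_pos_iff.2 (hne z hz.ge))]
    refine h.trans ?_
    gcongr
    have : 1 ≤ M ^ 2 := one_le_pow₀ hM1
    linarith
  · intro z hz
    have hz' : (z + ε).re = 2 + ε := by rw [add_re, ofReal_re, hz]
    have h1 : z ≠ 1 := fun h ↦ by rw [h, one_re] at hz; linarith
    have h2 : z + ε ≠ 1 := fun h ↦ by rw [h, one_re] at hz'; linarith
    have hn1 : 1 ≤ ‖z + ε - 1‖ := le_trans (by rw [sub_re, hz', one_re]; linarith)
      (re_le_norm (z + ε - 1))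
    have hn : ‖z - 1‖ ≤ 2 * ‖z + ε - 1‖ := by
      have h3 : z - 1 = (z + ε - 1) - ε := by ring
      rw [h3]
      refine (norm_sub_le _ _).trans ?_
      rw [norm_real, Real.norm_of_nonneg hε.le]
      linarith
    have hMp : 0 < M := by linarith
    have hlow := (hM (z + ε) (by linarith)).2
    have hpow : (1 : ℝ) ≤ (1 + |z.im|) ^ (1 / 4 : ℝ) :=
      Real.one_le_rpow (by linarith [abs_nonneg z.im]) (by norm_num)
    rw [norm_div, div_le_iff₀ (norm_pos_iff.2 (hne z (by linarith))), riemannZeta₁_eq_mul h1,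
      riemannZeta₁_eq_mul h2, norm_mul, norm_mul]
    calc ‖z - 1‖ * ‖riemannZeta z‖ ≤ (2 * ‖z + ε - 1‖) * M := by
          gcongr; exact (hM z hz.ge).1
      _ = 2 * M ^ 2 * 1 * (‖z + ε - 1‖ * M⁻¹) := by field_simp
      _ ≤ 36 * M ^ 2 * (1 + |z.im|) ^ (1 / 4 : ℝ) * (‖z + ε - 1‖ * ‖riemannZeta (z + ε)‖) := by
          gcongr
          norm_num

/-! ### Approximating the Mellin transform of the indicator -/

theorem ae_riemannZeta_critLine_ne_zero : ∀ᵐ t : ℝ, riemannZeta (critLine t) ≠ 0 := by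
  have hinj : Function.Injective critLine := fun x y h ↦ by
    have := congrArg im h
    rw [critLine_im, critLine_im] at this
    exact mul_left_cancel₀ (by positivity) this
  have hc : riemannZetaZeros.Countable :=
    (HereditarilyLindelofSpace.isLindelof riemannZetaZeros).countable_of_isDiscrete
      isDiscrete_riemannZetaZeros
  filter_upwards [(hc.preimage hinj).ae_notMem volume] with t ht h
  exact ht (mem_riemannZetaZeros.2 h)

theorem one_add_abs_le_norm_critLine (t : ℝ) : 1 + |t| ≤ 4 * ‖critLine t‖ := by
  have h1 := re_le_norm (critLine t)
  have h2 := abs_im_le_norm (critLine t)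
  rw [critLine_re] at h1
  rw [critLine_im, abs_mul, abs_of_pos (by positivity)] at h2
  nlinarith [Real.pi_gt_three, abs_nonneg t]

theorem memLp_one_add_abs_rpow :
    MemLp (fun t : ℝ ↦ (1 + |t|) ^ (-(3 / 4) : ℝ)) 2 := by
  have hc : Continuous fun t : ℝ ↦ (1 + |t|) ^ (-(3 / 4) : ℝ) :=
    (by fun_prop : Continuous fun t : ℝ ↦ 1 + |t|).rpow_const fun t ↦ Or.inl (by positivity)
  rw [memLp_two_iff_integrable_sq hc.aestronglyMeasurable]
  have := integrable_one_add_norm (E := ℝ) (μ := volume) (r := 3 / 2) (by norm_num)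
  refine this.congr (Eventually.of_forall fun t ↦ ?_)
  dsimp only
  rw [Real.norm_eq_abs, ← Real.rpow_mul_natCast (by positivity)]
  norm_num

theorem rpow_div_norm_critLine_le {C : ℝ} (hC : 0 < C) (t : ℝ) :
    C * (1 + |(critLine t).im|) ^ (1 / 4 : ℝ) / ‖critLine t‖ ≤
      28 * C * (1 + |t|) ^ (-(3 / 4) : ℝ) := by
  have ht : 0 < 1 + |t| := by positivity
  have hn : 0 < ‖critLine t‖ := norm_pos_iff.2 (critLine_ne_zero t)
  have h1 : 1 + |(critLine t).im| ≤ 7 ^ (4 : ℝ) * (1 + |t|) := by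
    rw [critLine_im, abs_mul, abs_of_pos (by positivity)]
    norm_num
    nlinarith [Real.pi_lt_four, abs_nonneg t]
  have h2 : (1 + |(critLine t).im|) ^ (1 / 4 : ℝ) ≤ 7 * (1 + |t|) ^ (1 / 4 : ℝ) := by
    refine (Real.rpow_le_rpow (by positivity) h1 (by norm_num)).trans (le_of_eq ?_)
    rw [Real.mul_rpow (by positivity) ht.le, ← Real.rpow_mul (by norm_num)]
    norm_num
  have h3 : (1 + |t|) ^ (1 / 4 : ℝ) = (1 + |t|) ^ (-(3 / 4) : ℝ) * (1 + |t|) := by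
    rw [← Real.rpow_add_one ht.ne']
    norm_num
  rw [div_le_iff₀ hn]
  calc C * (1 + |(critLine t).im|) ^ (1 / 4 : ℝ)
      ≤ C * (7 * ((1 + |t|) ^ (-(3 / 4) : ℝ) * (1 + |t|))) := by rw [← h3]; gcongr
    _ ≤ C * (7 * ((1 + |t|) ^ (-(3 / 4) : ℝ) * (4 * ‖critLine t‖))) := by
        gcongr
        exact one_add_abs_le_norm_critLine t
    _ = _ := by ring

theorem mul_norm_le_norm_one_add_mul {η : ℝ} (hη : 0 < η) {s : ℂ} (hs : 0 ≤ s.re) :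
    1 ≤ ‖1 + η * s‖ ∧ 1 + ‖s‖ ≤ (1 + η⁻¹) * ‖1 + η * s‖ := by
  have h1 : 1 ≤ ‖1 + η * s‖ := le_trans
    (by rw [add_re, one_re, re_ofReal_mul]; nlinarith) (re_le_norm (1 + η * s))
  refine ⟨h1, ?_⟩
  have h2 : η * ‖s‖ ≤ ‖1 + η * s‖ := by
    refine le_of_sq_le_sq ?_ (norm_nonneg _)
    rw [mul_pow, ← normSq_eq_norm_sq, ← normSq_eq_norm_sq, normSq_apply, normSq_apply]
    simp
    nlinarith
  have h3 : ‖s‖ ≤ η⁻¹ * ‖1 + η * s‖ := by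
    rwa [inv_mul_eq_div, le_div_iff₀ hη, mul_comm]
  linarith

theorem regularized_mem_multipliers (hRH : RiemannHypothesis) {ε : ℝ} (hε : 0 < ε)
    (hε1 : ε ≤ 1) : ∃ N : ℕ, ∀ η : ℝ, 0 < η →
      (fun t ↦ (critLine t - 1) / riemannZeta₁ (critLine t + ε) /
        (1 + η * critLine t) ^ N) ∈ multipliers := by
  obtain ⟨C, N, hC, hN⟩ := exists_inv_riemannZeta₁_le hRH hε hε1
  refine ⟨N + 1, fun η hη ↦ ?_⟩
  have hd : ∀ s : ℂ, 1 / 2 ≤ s.re → DifferentiableAt ℂ (fun s ↦ (s - 1) / riemannZeta₁ (s + ε) /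
      (1 + η * s) ^ (N + 1)) s := fun s hs ↦ by
    have h1 := (mul_norm_le_norm_one_add_mul hη (s := s) (by linarith)).1
    refine DifferentiableAt.div (DifferentiableAt.div (by fun_prop)
      (differentiable_riemannZeta₁.comp (differentiable_id.add_const _)).differentiableAt
      (riemannZeta₁_ne_zero hRH ?_)) (by fun_prop) (pow_ne_zero _ ?_)
    · rw [add_re, ofReal_re]; linarith
    · rw [← norm_pos_iff]; linarith
  refine mem_multipliers_of_bounded (p := fun s ↦ (s - 1) / riemannZeta₁ (s + ε) /
    (1 + η * s) ^ (N + 1)) (C := C * 2 ^ N * (1 + η⁻¹) ^ (N + 1))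
    (fun s hs ↦ (hd s (le_of_lt hs)).differentiableWithinAt)
    (fun s hs ↦ (hd s hs).continuousAt.continuousWithinAt) fun s hs ↦ ?_
  obtain ⟨h1, h2⟩ := mul_norm_le_norm_one_add_mul hη (s := s) (by linarith)
  rw [norm_div, norm_pow, div_le_iff₀ (by positivity), div_eq_mul_inv, norm_mul]
  have h3 : ‖s - 1‖ ≤ 1 + ‖s‖ := (norm_sub_le _ _).trans (by simp [add_comm])
  have h4 : 1 + ‖s + ε‖ ≤ 2 * (1 + ‖s‖) := by
    have := norm_add_le s (ε : ℂ)
    rw [norm_real, Real.norm_of_nonneg hε.le] at this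
    linarith [norm_nonneg s]
  calc ‖s - 1‖ * ‖(riemannZeta₁ (s + ε))⁻¹‖ ≤ (1 + ‖s‖) * (C * (2 * (1 + ‖s‖)) ^ N) := by
        gcongr
        refine (hN _ (by rw [add_re, ofReal_re]; linarith)).trans ?_
        gcongr
    _ = C * 2 ^ N * (1 + ‖s‖) ^ (N + 1) := by rw [mul_pow 2]; ring
    _ ≤ C * 2 ^ N * ((1 + η⁻¹) * ‖1 + η * s‖) ^ (N + 1) := by gcongr
    _ = _ := by rw [mul_pow (1 + η⁻¹), ← mul_assoc]

theorem approachable_ratio (hRH : RiemannHypothesis) {C : ℝ} (hC : 0 < C) {ε : ℝ} (hε : 0 < ε)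
    (hε1 : ε ≤ 1) (hr : ∀ s : ℂ, s.re = 1 / 2 →
      ‖riemannZeta₁ s / riemannZeta₁ (s + ε)‖ ≤ C * (1 + |s.im|) ^ (1 / 4 : ℝ)) :
    Approachable fun t ↦
      riemannZeta₁ (critLine t) / riemannZeta₁ (critLine t + ε) / critLine t := by
  obtain ⟨N, hN⟩ := regularized_mem_multipliers hRH hε hε1
  have heq : ∀ (η t : ℝ), ((fun t ↦ (critLine t - 1) / riemannZeta₁ (critLine t + ε) /
      (1 + η * critLine t) ^ N) * critZeta) t =
      riemannZeta₁ (critLine t) / riemannZeta₁ (critLine t + ε) / critLine t /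
        (1 + η * critLine t) ^ N := fun η t ↦ by
    rw [Pi.mul_apply, critZeta, riemannZeta₁_eq_mul (critLine_ne_one t)]
    ring
  refine approachable_of_tendsto (memLp_one_add_abs_rpow.const_mul (28 * C))
    (fun n : ℕ ↦ (hN (1 / ((n : ℝ) + 1)) (by positivity)).2.2)
    (fun n ↦ Eventually.of_forall fun t ↦ ?_) (Eventually.of_forall fun t ↦ ?_)
  · rw [heq, norm_div, norm_pow, norm_div]
    have h1 := (mul_norm_le_norm_one_add_mul (η := 1 / ((n : ℝ) + 1)) (by positivity)
      (s := critLine t) (by rw [critLine_re]; norm_num)).1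
    refine (div_le_self (by positivity) (one_le_pow₀ h1)).trans ?_
    refine le_trans ?_ (rpow_div_norm_critLine_le hC t)
    gcongr
    exact hr _ (critLine_re t)
  · simp only [heq]
    have h1 : Tendsto (fun n : ℕ ↦ ((1 / ((n : ℝ) + 1) : ℝ) : ℂ)) atTop (𝓝 ((0 : ℝ) : ℂ)) :=
      (continuous_ofReal.tendsto 0).comp tendsto_one_div_add_atTop_nhds_zero_nat
    have h2 := ((h1.mul_const (critLine t)).const_add 1).pow N
    simp only [ofReal_zero, zero_mul, add_zero, one_pow] at h2
    have h3 := (tendsto_const_nhds (x := riemannZeta₁ (critLine t) /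
      riemannZeta₁ (critLine t + ε) / critLine t)).div h2 one_ne_zero
    rwa [div_one] at h3

theorem approachable_inv_critLine (hRH : RiemannHypothesis) :
    Approachable fun t ↦ (critLine t)⁻¹ := by
  obtain ⟨C, hC, hr⟩ := exists_norm_ratio_le hRH
  have hpos : ∀ n : ℕ, 0 < 1 / 4 * (1 / ((n : ℝ) + 1)) := fun n ↦ by positivity
  have hle : ∀ n : ℕ, 1 / 4 * (1 / ((n : ℝ) + 1)) ≤ 1 / 4 := fun n ↦
    mul_le_of_le_one_right (by norm_num)
      ((div_le_one (by positivity)).2 (by linarith [n.cast_nonneg (α := ℝ)]))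
  refine approachable_of_tendsto (memLp_one_add_abs_rpow.const_mul (28 * C))
    (fun n : ℕ ↦ approachable_ratio hRH hC (hpos n) ((hle n).trans (by norm_num))
      (hr _ (hpos n) (hle n)))
    (fun n ↦ Eventually.of_forall fun t ↦ ?_) ?_
  · rw [norm_div]
    refine le_trans ?_ (rpow_div_norm_critLine_le hC t)
    gcongr
    exact hr _ (hpos n) (hle n) _ (critLine_re t)
  · filter_upwards [ae_riemannZeta_critLine_ne_zero] with t ht
    have hZ : riemannZeta₁ (critLine t) ≠ 0 := by
      rw [riemannZeta₁_eq_mul (critLine_ne_one t)]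
      exact mul_ne_zero (sub_ne_zero.2 (critLine_ne_one t)) ht
    have h1 : Tendsto (fun n : ℕ ↦ ((1 / 4 * (1 / ((n : ℝ) + 1)) : ℝ) : ℂ)) atTop
        (𝓝 ((1 / 4 * 0 : ℝ) : ℂ)) :=
      (continuous_ofReal.tendsto _).comp (tendsto_one_div_add_atTop_nhds_zero_nat.const_mul _)
    have h2 := (differentiable_riemannZeta₁.continuous.tendsto _).comp
      (h1.const_add (critLine t))
    rw [mul_zero, ofReal_zero, add_zero] at h2
    have h3 := ((tendsto_const_nhds (x := riemannZeta₁ (critLine t))).div h2 hZ).div_const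
      (critLine t)
    rwa [div_self hZ, one_div (critLine t)] at h3

/-! ### The Riemann Hypothesis implies approximability -/

theorem exists_hasMellin_of_mem_powSpan {P : ℝ → ℂ} (hP : P ∈ powSpan) :
    ∃ lam : ℝ, 0 < lam ∧ lam < 1 ∧
      ∃ f ∈ Submodule.span ℂ
          {g : ℝ → ℂ | ∃ θ : ℝ, lam ≤ θ ∧ θ ≤ 1 ∧
            g = fun t => ((Int.fract (θ / t) : ℝ) : ℂ)},
        MemLp f 2 (volume.restrict (Ioi 0)) ∧
          ∀ t, HasMellin f (critLine t) (P t * critZeta t) := by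
  have mono : ∀ lam lam' : ℝ, lam ≤ lam' → Submodule.span ℂ
      {g : ℝ → ℂ | ∃ θ : ℝ, lam' ≤ θ ∧ θ ≤ 1 ∧ g = fun t => ((Int.fract (θ / t) : ℝ) : ℂ)} ≤
      Submodule.span ℂ
      {g : ℝ → ℂ | ∃ θ : ℝ, lam ≤ θ ∧ θ ≤ 1 ∧ g = fun t => ((Int.fract (θ / t) : ℝ) : ℂ)} :=
    fun lam lam' h ↦ Submodule.span_mono fun g ⟨θ, h1, h2, h3⟩ ↦ ⟨θ, h.trans h1, h2, h3⟩
  induction hP using Submodule.span_induction with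
  | mem x hx =>
    obtain ⟨θ, h0, h1, rfl⟩ := hx
    refine ⟨min θ (1 / 2), by positivity, (min_le_right _ _).trans_lt (by norm_num),
      (-1 : ℂ) • fun t : ℝ ↦ ((Int.fract (θ / t) : ℝ) : ℂ),
      Submodule.smul_mem _ _ (Submodule.subset_span ⟨θ, min_le_left _ _, h1, rfl⟩),
      (memLp_fract_div h0 h1).const_smul (-1 : ℂ), fun t ↦ ?_⟩
    have h := hasMellin_fract_div h0 (s := critLine t) (by rw [critLine_re]; norm_num)
      (by rw [critLine_re]; norm_num)
    have h2 := hasMellin_const_smul h.1 (-1 : ℂ)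
    rw [h.2, smul_eq_mul, neg_one_mul, neg_neg] at h2
    exact h2
  | zero =>
    refine ⟨1 / 2, by norm_num, by norm_num, 0, zero_mem _, MemLp.zero, fun t ↦ ?_⟩
    simp [HasMellin, MellinConvergent, mellin]
  | add x y _ _ hx hy =>
    obtain ⟨l, hl0, hl1, f, hf, hf2, hfm⟩ := hx
    obtain ⟨m, hm0, hm1, g, hg, hg2, hgm⟩ := hy
    refine ⟨min l m, lt_min hl0 hm0, (min_le_left _ _).trans_lt hl1, f + g,
      add_mem (mono _ _ (min_le_left _ _) hf) (mono _ _ (min_le_right _ _) hg), hf2.add hg2,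
      fun t ↦ ?_⟩
    have h := hasMellin_add (hfm t).1 (hgm t).1
    rw [(hfm t).2, (hgm t).2, ← add_mul] at h
    exact h
  | smul c x _ hx =>
    obtain ⟨l, hl0, hl1, f, hf, hf2, hfm⟩ := hx
    refine ⟨l, hl0, hl1, c • f, Submodule.smul_mem _ _ hf, hf2.const_smul c, fun t ↦ ?_⟩
    have h := hasMellin_const_smul (hfm t).1 c
    rw [(hfm t).2, smul_eq_mul, ← mul_assoc] at h
    exact h

theorem approximable_of_riemannHypothesis (hRH : RiemannHypothesis) : IndicatorApproximable := by
  intro ε hε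
  obtain ⟨P, hP, hle⟩ := (approachable_inv_critLine hRH).2 (ENNReal.ofReal (ε / 2))
    (ENNReal.ofReal_pos.2 (by positivity))
  obtain ⟨lam, h0, h1, f, hf, hf2, hfm⟩ := exists_hasMellin_of_mem_powSpan hP
  refine ⟨lam, h0, h1, f, hf, ?_⟩
  have hm : ∀ t, HasMellin (fun u ↦ indicator (Ioc (0 : ℝ) 1) (fun _ ↦ (1 : ℂ)) u - f u)
      (critLine t) ((critLine t)⁻¹ - P t * critZeta t) := fun t ↦ by
    have h2 := hasMellin_one_Ioc (s := critLine t) (by rw [critLine_re]; norm_num)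
    have h3 := hasMellin_sub h2.1 (hfm t).1
    rwa [h2.2, (hfm t).2, one_div] at h3
  have hc : critLine 0 = 1 / 2 := by simp [critLine]
  rw [← eLpNorm_mellin_critLine
    (f := fun u ↦ indicator (Ioc (0 : ℝ) 1) (fun _ ↦ (1 : ℂ)) u - f u)
    (hc ▸ (hm 0).1) (memLp_indicator_Ioc.sub hf2)]
  have heq : (fun t ↦ mellin (fun u ↦ indicator (Ioc (0 : ℝ) 1) (fun _ ↦ (1 : ℂ)) u - f u)
      (critLine t)) = (fun t ↦ (critLine t)⁻¹) - P * critZeta := funext fun t ↦ (hm t).2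
  rw [heq]
  refine hle.trans_lt ((ENNReal.ofReal_lt_ofReal_iff hε).2 (by linarith))

end NymanBeurling

/-- The Nyman–Beurling criterion: the Riemann Hypothesis holds if and only if the
indicator function `χ` of `(0,1]` belongs to the closure in `K = L²((0,∞), dt)` of the
union over `0 < λ < 1` of the spans `B_λ` of the functions `t ↦ {θ/t}`, `λ ≤ θ ≤ 1`. -/
theorem nyman_beurling :
    RiemannHypothesis ↔
      ∀ ε : ℝ, 0 < ε → ∃ lam : ℝ, 0 < lam ∧ lam < 1 ∧
        ∃ f ∈ Submodule.span ℂ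
            {g : ℝ → ℂ | ∃ θ : ℝ, lam ≤ θ ∧ θ ≤ 1 ∧
              g = fun t => ((Int.fract (θ / t) : ℝ) : ℂ)},
          eLpNorm
              (fun t => Set.indicator (Set.Ioc (0:ℝ) 1) (fun _ => (1:ℂ)) t - f t) 2
              (volume.restrict (Set.Ioi (0:ℝ)))
            < ENNReal.ofReal ε :=
  ⟨NymanBeurling.approximable_of_riemannHypothesis,
    NymanBeurling.riemannHypothesis_of_approximable⟩
end

section
/- For every complex number s with 0 < Re s < 1, the integral ∫₀^∞ {1/t}·t^{s−1} dt converges absolutely and equals −ζ(s)/s, where ζ is the Riemann zeta function and {x} denotes the fractional part of x. -/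
open MeasureTheory Set

open Filter Topology Asymptotics

lemma locallyIntegrableOn_of_norm_le_one {f : ℝ → ℂ} (hf : Measurable f) (h : ∀ t, ‖f t‖ ≤ 1)
    (s : Set ℝ) : LocallyIntegrableOn f s :=
  ((locallyIntegrable_const (1 : ℝ)).mono hf.aestronglyMeasurable
    (.of_forall fun t ↦ by simpa using h t)).locallyIntegrableOn s

lemma norm_fract_le_one (t : ℝ) : ‖((Int.fract t : ℝ) : ℂ)‖ ≤ 1 := by
  rw [Complex.norm_real, Real.norm_of_nonneg (Int.fract_nonneg t)]
  exact (Int.fract_lt_one t).le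

lemma isBigO_one_atTop_of_norm_le_one {f : ℝ → ℂ} (h : ∀ t, ‖f t‖ ≤ 1) :
    f =O[atTop] (· ^ (-(0 : ℝ)) : ℝ → ℝ) :=
  .of_bound 1 (.of_forall fun t ↦ by simpa using h t)

lemma measurable_ofReal_fract : Measurable fun t : ℝ ↦ ((Int.fract t : ℝ) : ℂ) :=
  Complex.measurable_ofReal.comp measurable_fract

lemma mellinConvergent_fract {s : ℂ} (h0 : -1 < s.re) (h1 : s.re < 0) :
    MellinConvergent (fun t : ℝ ↦ ((Int.fract t : ℝ) : ℂ)) s := by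
  refine mellinConvergent_of_isBigO_rpow (a := 0) (b := -1)
    (locallyIntegrableOn_of_norm_le_one measurable_ofReal_fract norm_fract_le_one _)
    (isBigO_one_atTop_of_norm_le_one norm_fract_le_one) h1 ?_ h0
  refine .of_bound 1 ?_
  filter_upwards [Ioo_mem_nhdsGT one_pos] with t ht
  simp [Int.fract_eq_self.2 ⟨ht.1.le, ht.2⟩]

/-- The fractional part, cut off to `(1, ∞)`. -/
noncomputable def fractTail : ℝ → ℂ :=
  indicator (Ioi 1) fun t : ℝ ↦ ((Int.fract t : ℝ) : ℂ)

lemma measurable_fractTail : Measurable fractTail :=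
  measurable_ofReal_fract.indicator measurableSet_Ioi

lemma norm_fractTail_le_one (t : ℝ) : ‖fractTail t‖ ≤ 1 :=
  (norm_indicator_le_norm_self _ _).trans (norm_fract_le_one t)

lemma fractTail_isBigO_zero (b : ℝ) : fractTail =O[𝓝[>] 0] (· ^ (-b) : ℝ → ℝ) := by
  refine (isBigO_zero _ _).congr' ?_ .rfl
  filter_upwards [Ioo_mem_nhdsGT one_pos] with t ht
  simp [fractTail, ht.2.le]

lemma differentiableAt_mellin_fractTail {s : ℂ} (hs : s.re < 0) :
    DifferentiableAt ℂ (mellin fractTail) s :=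
  mellin_differentiableAt_of_isBigO_rpow
    (locallyIntegrableOn_of_norm_le_one measurable_fractTail norm_fractTail_le_one _)
    (isBigO_one_atTop_of_norm_le_one norm_fractTail_le_one) hs
    (fractTail_isBigO_zero (s.re - 1)) (sub_one_lt _)

lemma mellinConvergent_fractTail {s : ℂ} (hs : s.re < 0) : MellinConvergent fractTail s :=
  mellinConvergent_of_isBigO_rpow
    (locallyIntegrableOn_of_norm_le_one measurable_fractTail norm_fractTail_le_one _)
    (isBigO_one_atTop_of_norm_le_one norm_fractTail_le_one) hs
    (fractTail_isBigO_zero (s.re - 1)) (sub_one_lt _)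

lemma cpow_smul_fractTail (s : ℂ) :
    (fun t : ℝ ↦ (t : ℂ) ^ (s - 1) • fractTail t) =
      indicator (Ioi 1) fun t : ℝ ↦ (t : ℂ) ^ (s - 1) • ((Int.fract t : ℝ) : ℂ) := by
  ext t
  by_cases ht : t ∈ Ioi (1 : ℝ) <;> simp only [fractTail, indicator, ht, if_true, if_false,
    smul_zero]

lemma mellin_fractTail (s : ℂ) :
    mellin fractTail s = ∫ t in Ioi (1 : ℝ), (t : ℂ) ^ (s - 1) • ((Int.fract t : ℝ) : ℂ) := by
  rw [mellin, cpow_smul_fractTail, setIntegral_indicator measurableSet_Ioi,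
    inter_eq_self_of_subset_right (Ioi_subset_Ioi zero_le_one)]

lemma integrableOn_cpow_smul_fract {s : ℂ} (hs : s.re < 0) :
    IntegrableOn (fun t : ℝ ↦ (t : ℂ) ^ (s - 1) • ((Int.fract t : ℝ) : ℂ)) (Ioi 1) := by
  have h := mellinConvergent_fractTail hs
  rw [MellinConvergent, cpow_smul_fractTail] at h
  have h' := h.mono_set (Ioi_subset_Ioi zero_le_one : Ioi (1 : ℝ) ⊆ Ioi 0)
  refine h'.congr_fun (fun t ht ↦ ?_) measurableSet_Ioi
  exact indicator_of_mem ht _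

lemma mellin_fractTail_of_one_lt_re {s : ℂ} (hs : 1 < s.re) :
    mellin fractTail (-s) = 1 / (s - 1) - riemannZeta s / s := by
  have hs0 : s ≠ 0 := Complex.ne_zero_of_one_lt_re hs
  have hL := LSeries_eq_mul_integral_of_nonneg (fun _ ↦ 1) zero_le_one (s := s) hs
    (by simpa using isBigO_refl _ _) (fun _ ↦ zero_le_one)
  have hone : LSeries (fun _ ↦ ((1 : ℝ) : ℂ)) s = riemannZeta s := by
    rw [← LSeries_one_eq_riemannZeta hs, Complex.ofReal_one]
    rfl
  rw [hone] at hL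
  have hfloor : ∫ t in Ioi (1 : ℝ), (∑ k ∈ Finset.Icc 1 ⌊t⌋₊, ((1 : ℝ) : ℂ)) * t ^ (-(s + 1)) =
      ∫ t in Ioi (1 : ℝ), ((t : ℂ) ^ (-s) - (t : ℂ) ^ (-s - 1) • ((Int.fract t : ℝ) : ℂ)) := by
    refine setIntegral_congr_fun measurableSet_Ioi fun t ht ↦ ?_
    have ht0 : 0 < t := one_pos.trans ht
    have htc : (t : ℂ) ≠ 0 := by exact_mod_cast ht0.ne'
    have hf : ((⌊t⌋₊ : ℕ) : ℂ) = t - (Int.fract t : ℝ) := by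
      have : ((⌊t⌋₊ : ℕ) : ℝ) = t - Int.fract t := by
        rw [natCast_floor_eq_intCast_floor ht0.le, Int.self_sub_fract]
      exact_mod_cast congrArg (Complex.ofReal) this
    have hp : (t : ℂ) ^ (-s) = t * (t : ℂ) ^ (-s - 1) := by
      rw [Complex.cpow_sub _ _ htc, Complex.cpow_one, mul_div_cancel₀ _ htc]
    simp only [Complex.ofReal_one, Finset.sum_const, Nat.card_Icc, add_tsub_cancel_right,
      nsmul_eq_mul, mul_one, smul_eq_mul]
    rw [hf, hp, show -(s + 1) = -s - 1 by ring]
    ring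
  have hre : (-s).re < -1 := by simpa using hs
  rw [hfloor, integral_sub (integrableOn_Ioi_cpow_of_lt hre one_pos)
    (integrableOn_cpow_smul_fract (hre.trans (by norm_num))), ← mellin_fractTail,
    integral_Ioi_cpow_of_lt hre one_pos] at hL
  rw [hL, Complex.ofReal_one, Complex.one_cpow, mul_div_cancel_left₀ _ hs0,
    ← neg_div_neg_eq 1 (s - 1)]
  ring_nf

lemma mellin_fractTail_of_re_pos {s : ℂ} (hs : 0 < s.re) (hs1 : s ≠ 1) :
    mellin fractTail (-s) = 1 / (s - 1) - riemannZeta s / s := by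
  let U : Set ℂ := {z | 0 < z.re}
  have hU : IsOpen U := isOpen_lt continuous_const Complex.continuous_re
  have hf : AnalyticOnNhd ℂ (fun z ↦ z * (z - 1) * mellin fractTail (-z)) U := by
    refine DifferentiableOn.analyticOnNhd (fun z hz ↦ ?_) hU
    have h := (differentiableAt_mellin_fractTail (s := -z) (by simpa [U] using hz)).comp z
      differentiableAt_id.neg
    exact (DifferentiableAt.mul (by fun_prop) h).differentiableWithinAt
  have hg : AnalyticOnNhd ℂ (fun z ↦ z - riemannZeta₁ z) U :=
    (differentiable_id.sub differentiable_riemannZeta₁).differentiableOn.analyticOnNhd hU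
  have hev : (fun z ↦ z * (z - 1) * mellin fractTail (-z)) =ᶠ[𝓝 2]
      fun z ↦ z - riemannZeta₁ z := by
    filter_upwards [(isOpen_lt continuous_const Complex.continuous_re).mem_nhds
      (show (1 : ℝ) < (2 : ℂ).re by norm_num)] with z (hz : 1 < z.re)
    have hz0 : z ≠ 0 := Complex.ne_zero_of_one_lt_re hz
    have hz1 : z - 1 ≠ 0 := sub_ne_zero.2 fun h ↦ by simp [h] at hz
    rw [mellin_fractTail_of_one_lt_re hz, riemannZeta_eq_inv_sub_mul (sub_ne_zero.1 hz1)]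
    field_simp
  have key := hf.eqOn_of_preconnected_of_eventuallyEq hg
    (convex_halfSpace_re_gt 0).isPreconnected (show (2 : ℂ) ∈ U by simp [U]) hev hs
  have hs0 : s ≠ 0 := Complex.ne_zero_of_re_pos hs
  have hs1' : s - 1 ≠ 0 := sub_ne_zero.2 hs1
  simp only at key
  rw [riemannZeta_eq_inv_sub_mul hs1]
  field_simp
  linear_combination key

lemma mellin_fract {s : ℂ} (h0 : 0 < s.re) (h1 : s.re < 1) :
    mellin (fun t : ℝ ↦ ((Int.fract t : ℝ) : ℂ)) (-s) = -riemannZeta s / s := by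
  have hs1 : s ≠ 1 := fun h ↦ by simp [h] at h1
  have hconv : MellinConvergent (fun t : ℝ ↦ ((Int.fract t : ℝ) : ℂ)) (-s) :=
    mellinConvergent_fract (by simpa using h1) (by simpa using h0)
  have hIoc : ∫ t in Ioc (0 : ℝ) 1, (t : ℂ) ^ (-s - 1) • ((Int.fract t : ℝ) : ℂ) =
      1 / (1 - s) := by
    have hcongr : ∫ t in Ioo (0 : ℝ) 1, (t : ℂ) ^ (-s - 1) • ((Int.fract t : ℝ) : ℂ) =
        ∫ t in Ioo (0 : ℝ) 1, (t : ℂ) ^ (-s) := by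
      refine setIntegral_congr_fun measurableSet_Ioo fun t ht ↦ ?_
      have htc : (t : ℂ) ≠ 0 := by exact_mod_cast ht.1.ne'
      simp only [Int.fract_eq_self.2 ⟨ht.1.le, ht.2⟩, smul_eq_mul]
      rw [Complex.cpow_sub _ _ htc, Complex.cpow_one, div_mul_cancel₀ _ htc]
    have hne : -s + 1 ≠ 0 := fun h ↦ hs1 (by linear_combination -h)
    rw [integral_Ioc_eq_integral_Ioo, hcongr, ← integral_Ioc_eq_integral_Ioo,
      ← intervalIntegral.integral_of_le zero_le_one,
      integral_cpow (Or.inl (by simpa using h1)), Complex.ofReal_one, Complex.ofReal_zero,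
      Complex.one_cpow, Complex.zero_cpow hne]
    ring_nf
  rw [mellin, ← Ioc_union_Ioi_eq_Ioi zero_le_one,
    setIntegral_union (Ioc_disjoint_Ioi le_rfl) measurableSet_Ioi
      (hconv.mono_set Ioc_subset_Ioi_self) (hconv.mono_set (Ioi_subset_Ioi zero_le_one)),
    hIoc, ← mellin_fractTail, mellin_fractTail_of_re_pos h0 hs1, ← neg_sub s 1,
    one_div_neg_eq_neg_one_div]
  ring

/-- For `0 < Re s < 1`, the integral `∫₀^∞ {1/t}·t^{s-1} dt` converges absolutely and
equals `-ζ(s)/s`. -/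
theorem integral_fract_inv_rpow (s : ℂ) (h0 : 0 < s.re) (h1 : s.re < 1) :
    MeasureTheory.IntegrableOn
        (fun t : ℝ => ((Int.fract (1/t) : ℝ) : ℂ) * (t : ℂ) ^ (s - 1)) (Set.Ioi 0) ∧
      ∫ t in Set.Ioi (0:ℝ), ((Int.fract (1/t) : ℝ) : ℂ) * (t : ℂ) ^ (s - 1)
        = - riemannZeta s / s := by
  have hfun : (fun t : ℝ ↦ ((Int.fract (1 / t) : ℝ) : ℂ) * (t : ℂ) ^ (s - 1)) =
      fun t : ℝ ↦ (t : ℂ) ^ (s - 1) • ((Int.fract t⁻¹ : ℝ) : ℂ) := by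
    ext t
    rw [one_div, smul_eq_mul, mul_comm]
  rw [hfun]
  constructor
  · have h := (MellinConvergent.comp_rpow (f := fun t : ℝ ↦ ((Int.fract t : ℝ) : ℂ)) (s := s)
      (a := -1) (by norm_num)).2 (mellinConvergent_fract
        (by simpa [div_neg] using h1) (by simpa [div_neg] using h0))
    simpa only [Real.rpow_neg_one] using! h
  · rw [← mellin_fract h0 h1]
    exact mellin_comp_inv (fun t : ℝ ↦ ((Int.fract t : ℝ) : ℂ)) s
end

section
/- For every complex number w with 0 < Re w < 1 and every real t > 0, the integral ∫₀^∞ u^{w−2}·sin(2πtu) du converges absolutely and equals (1/(1−w))·(2πt)^{1−w}·cos(πw/2)·Γ(w), where Γ is the Gamma function. -/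
open MeasureTheory Set
open Filter Topology

theorem norm_exp_neg_mul_ofReal_sub_one_le {r : ℂ} (hr : 0 ≤ r.re) {x : ℝ} (hx : 0 ≤ x) :
    ‖Complex.exp (-(r * x)) - 1‖ ≤ 2 * min 1 (‖r‖ * x) := by
  have hnorm : ‖-(r * (x : ℂ))‖ = ‖r‖ * x := by
    rw [norm_neg, norm_mul, Complex.norm_real, Real.norm_of_nonneg hx]
  rcases le_total (‖r‖ * x) 1 with h | h
  · rw [min_eq_right h, ← hnorm]
    exact Complex.norm_exp_sub_one_le (hnorm.trans_le h)
  · rw [min_eq_left h]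
    refine (norm_sub_le _ _).trans ?_
    have : ‖Complex.exp (-(r * x))‖ ≤ 1 := by
      rw [Complex.norm_exp, Real.exp_le_one_iff]
      simpa using mul_nonneg hr hx
    rw [norm_one]
    linarith

theorem integrableOn_rpow_mul_min {σ : ℝ} (h0 : -1 < σ) (h1 : σ < 0) {R : ℝ} (hR : 0 ≤ R) :
    IntegrableOn (fun x : ℝ => x ^ (σ - 1) * min 1 (R * x)) (Ioi 0) := by
  refine mellin_convergent_of_isBigO_scalar (a := 0) (b := -1) ?_ ?_ h1 ?_ h0
  · have : Continuous fun x : ℝ => min 1 (R * x) := by fun_prop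
    exact this.locallyIntegrable.locallyIntegrableOn _
  · refine Asymptotics.IsBigO.of_bound 1 ?_
    filter_upwards [eventually_ge_atTop 0] with x hx
    have : 0 ≤ min 1 (R * x) := le_min zero_le_one (by positivity)
    simp [abs_of_nonneg this]
  · refine Asymptotics.IsBigO.of_bound R ?_
    filter_upwards [self_mem_nhdsWithin] with x (hx : 0 < x)
    have : 0 ≤ min 1 (R * x) := le_min zero_le_one (by positivity)
    simp [abs_of_nonneg this, abs_of_pos hx]

theorem aestronglyMeasurable_cpow_mul (s : ℂ) {f : ℝ → ℂ} (hf : Continuous f) :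
    AEStronglyMeasurable (fun x : ℝ => (x : ℂ) ^ s * f x) (volume.restrict (Ioi 0)) := by
  refine ContinuousOn.aestronglyMeasurable ?_ measurableSet_Ioi
  refine ContinuousOn.mul (fun x hx => ?_) hf.continuousOn
  exact (Complex.continuousAt_ofReal_cpow_const _ _ (Or.inr (ne_of_gt hx))).continuousWithinAt

theorem norm_cpow_mul_exp_sub_one_le {s r : ℂ} (hr : 0 ≤ r.re) {R : ℝ} (hR : ‖r‖ ≤ R) {x : ℝ}
    (hx : 0 < x) :
    ‖(x : ℂ) ^ (s - 1) * (Complex.exp (-(r * x)) - 1)‖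
      ≤ 2 * (x ^ (s.re - 1) * min 1 (R * x)) := by
  rw [norm_mul, Complex.norm_cpow_eq_rpow_re_of_pos hx, Complex.sub_re, Complex.one_re,
    mul_left_comm]
  gcongr
  exact (norm_exp_neg_mul_ofReal_sub_one_le hr hx.le).trans (by gcongr)

theorem integrableOn_cpow_mul_exp_sub_one {s : ℂ} (h0 : -1 < s.re) (h1 : s.re < 0) {r : ℂ}
    (hr : 0 ≤ r.re) :
    IntegrableOn (fun x : ℝ => (x : ℂ) ^ (s - 1) * (Complex.exp (-(r * x)) - 1)) (Ioi 0) := by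
  refine ((integrableOn_rpow_mul_min h0 h1 (norm_nonneg r)).const_mul 2).mono'
    (aestronglyMeasurable_cpow_mul _ (by fun_prop)) ?_
  filter_upwards [ae_restrict_mem measurableSet_Ioi] with x hx
  exact norm_cpow_mul_exp_sub_one_le hr le_rfl hx

theorem integrableOn_cpow_mul_exp_neg_mul {s : ℂ} (h0 : -1 < s.re) {r : ℝ} (hr : 0 < r) :
    IntegrableOn (fun x : ℝ => (x : ℂ) ^ s * Complex.exp (-(r * x))) (Ioi 0) := by
  refine (integrableOn_rpow_mul_exp_neg_mul_rpow h0 one_pos hr).mono'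
    (aestronglyMeasurable_cpow_mul _ (by fun_prop)) ?_
  filter_upwards [ae_restrict_mem measurableSet_Ioi] with x hx
  rw [norm_mul, Complex.norm_cpow_eq_rpow_re_of_pos hx, Complex.norm_exp, Real.rpow_one]
  simp

theorem integral_cpow_mul_exp_sub_one_of_pos {s : ℂ} (h0 : -1 < s.re) (h1 : s.re < 0) {r : ℝ}
    (hr : 0 < r) :
    ∫ x in Ioi (0 : ℝ), (x : ℂ) ^ (s - 1) * (Complex.exp (-(r * x)) - 1)
      = Complex.Gamma s * (r : ℂ) ^ (-s) := by
  have hs : s ≠ 0 := by rintro rfl; simp at h1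
  have hrC : (r : ℂ) ≠ 0 := Complex.ofReal_ne_zero.mpr hr.ne'
  have hr_re : 0 ≤ (r : ℂ).re := hr.le
  have hbound : ∀ x : ℝ, 0 < x → ‖(x : ℂ) ^ s / s * (Complex.exp (-(r * x)) - 1)‖
      ≤ x ^ s.re / ‖s‖ * (2 * min 1 (‖(r : ℂ)‖ * x)) := fun x hx => by
    rw [norm_mul, norm_div, Complex.norm_cpow_eq_rpow_re_of_pos hx]
    gcongr
    exact norm_exp_neg_mul_ofReal_sub_one_le hr_re hx.le
  have parts := integral_Ioi_mul_deriv_eq_deriv_mul (a := (0 : ℝ)) (a' := (0 : ℂ)) (b' := (0 : ℂ))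
    (u := fun x : ℝ => (x : ℂ) ^ s / s) (u' := fun x : ℝ => (x : ℂ) ^ (s - 1))
    (v := fun x : ℝ => Complex.exp (-(r * x)) - 1)
    (v' := fun x : ℝ => -r * Complex.exp (-(r * x)))
    (fun x hx => by
      convert! (hasDerivAt_ofReal_cpow_const (ne_of_gt hx) hs).div_const s using 1
      field_simp)
    (fun x _ => by
      have : HasDerivAt (fun y : ℂ => Complex.exp (-(r * y)) - 1)
          (-r * Complex.exp (-(r * x))) (x : ℂ) := by
        convert! (((hasDerivAt_id (x : ℂ)).const_mul (r : ℂ)).neg.cexp).sub_const 1 using 1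
        simp [mul_comm]
      exact this.comp_ofReal)
    (by
      refine IntegrableOn.congr_fun ((integrableOn_cpow_mul_exp_neg_mul h0 hr).const_mul (-r / s))
        (fun x _ => ?_) measurableSet_Ioi
      simp only [Pi.mul_apply]
      ring)
    (integrableOn_cpow_mul_exp_sub_one h0 h1 hr_re)
    (by
      have lim : Tendsto (fun x : ℝ => 2 * ‖(r : ℂ)‖ / ‖s‖ * x ^ (s.re + 1)) (𝓝[>] 0) (𝓝 0) := by
        have := (Real.continuousAt_rpow_const 0 (s.re + 1) (Or.inr (by linarith))).tendsto
        rw [Real.zero_rpow (by linarith)] at this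
        simpa using (this.mono_left nhdsWithin_le_nhds).const_mul (2 * ‖(r : ℂ)‖ / ‖s‖)
      refine squeeze_zero_norm' ?_ lim
      filter_upwards [self_mem_nhdsWithin] with x (hx : 0 < x)
      refine (hbound x hx).trans ?_
      rw [Real.rpow_add_one hx.ne']
      calc _ ≤ x ^ s.re / ‖s‖ * (2 * (‖(r : ℂ)‖ * x)) := by gcongr; exact min_le_right _ _
        _ = _ := by ring)
    (by
      have lim : Tendsto (fun x : ℝ => 2 / ‖s‖ * x ^ s.re) atTop (𝓝 0) := by
        simpa using (tendsto_rpow_neg_atTop (y := -s.re) (by linarith)).const_mul (2 / ‖s‖)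
      refine squeeze_zero_norm' ?_ lim
      filter_upwards [eventually_gt_atTop 0] with x hx
      refine (hbound x hx).trans ?_
      calc _ ≤ x ^ s.re / ‖s‖ * (2 * 1) := by gcongr; exact min_le_left _ _
        _ = _ := by ring)
  have hGamma := Complex.integral_cpow_mul_exp_neg_mul_Ioi (a := s + 1)
    (by simpa using by linarith) hr
  rw [add_sub_cancel_right] at hGamma
  have hleft : ∫ x in Ioi (0 : ℝ), (x : ℂ) ^ s / s * (-r * Complex.exp (-(r * x)))
      = -r / s * ((1 / r : ℂ) ^ (s + 1) * Complex.Gamma (s + 1)) := by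
    rw [← hGamma, ← integral_const_mul]
    congr 1 with x
    ring
  rw [hleft, Complex.Gamma_add_one s hs, one_div, Complex.inv_cpow _ _
    (by rw [Complex.arg_ofReal_of_nonneg hr.le]; exact Real.pi_pos.ne),
    Complex.cpow_add _ _ hrC, Complex.cpow_one] at parts
  rw [Complex.cpow_neg]
  have hpow : (r : ℂ) ^ s ≠ 0 := by simp [Complex.cpow_eq_zero_iff, hrC]
  field_simp at parts ⊢
  linear_combination parts

theorem differentiableOn_integral_cpow_mul_exp_sub_one {s : ℂ} (h0 : -1 < s.re) (h1 : s.re < 0) :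
    DifferentiableOn ℂ
      (fun r : ℂ => ∫ x in Ioi (0 : ℝ), (x : ℂ) ^ (s - 1) * (Complex.exp (-(r * x)) - 1))
      {r : ℂ | 0 < r.re} := by
  intro r (hr : 0 < r.re)
  have hball : ∀ z ∈ Metric.ball r (r.re / 2), r.re / 2 < z.re := fun z hz => by
    have := (Complex.abs_re_le_norm (z - r)).trans_lt (mem_ball_iff_norm.mp hz)
    rw [Complex.sub_re, abs_lt] at this
    linarith
  refine (hasDerivAt_integral_of_dominated_loc_of_deriv_le
    (F := fun (z : ℂ) (x : ℝ) => (x : ℂ) ^ (s - 1) * (Complex.exp (-(z * x)) - 1))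
    (F' := fun (z : ℂ) (x : ℝ) => (x : ℂ) ^ (s - 1) * (Complex.exp (-(z * x)) * (-x)))
    (bound := fun x : ℝ => x ^ s.re * Real.exp (-(r.re / 2) * x ^ (1 : ℝ)))
    (Metric.ball_mem_nhds r (half_pos hr))
    (Eventually.of_forall fun z => aestronglyMeasurable_cpow_mul _ (by fun_prop))
    (integrableOn_cpow_mul_exp_sub_one h0 h1 hr.le)
    (aestronglyMeasurable_cpow_mul _ (by fun_prop)) ?_
    (integrableOn_rpow_mul_exp_neg_mul_rpow h0 one_pos (half_pos hr))
    ?_).2.differentiableAt.differentiableWithinAt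
  · filter_upwards [ae_restrict_mem measurableSet_Ioi] with x (hx : 0 < x) z hz
    rw [norm_mul, norm_mul, Complex.norm_cpow_eq_rpow_re_of_pos hx, Complex.norm_exp, norm_neg,
      Complex.norm_real, Real.norm_of_nonneg hx.le, Complex.sub_re, Complex.one_re,
      mul_comm (Real.exp _), ← mul_assoc, ← Real.rpow_add_one hx.ne', sub_add_cancel, Real.rpow_one]
    gcongr
    simp only [Complex.neg_re, Complex.re_mul_ofReal, neg_mul, neg_le_neg_iff]
    have := hball z hz
    gcongr
  · refine Eventually.of_forall fun x z _ => HasDerivAt.const_mul _ ?_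
    simpa using (((hasDerivAt_id z).mul_const (x : ℂ)).neg.cexp).sub_const 1

theorem integral_cpow_mul_exp_sub_one_of_re_pos {s : ℂ} (h0 : -1 < s.re) (h1 : s.re < 0) {r : ℂ}
    (hr : 0 < r.re) :
    ∫ x in Ioi (0 : ℝ), (x : ℂ) ^ (s - 1) * (Complex.exp (-(r * x)) - 1)
      = Complex.Gamma s * r ^ (-s) := by
  have hopen : IsOpen {z : ℂ | 0 < z.re} := isOpen_lt continuous_const Complex.continuous_re
  refine ((differentiableOn_integral_cpow_mul_exp_sub_one h0 h1).analyticOnNhd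
    hopen).eqOn_of_preconnected_of_frequently_eq (z₀ := 1)
    (g := fun z => Complex.Gamma s * z ^ (-s)) (DifferentiableOn.analyticOnNhd ?_ hopen)
    (convex_halfSpace_re_gt 0).isPreconnected (by simp) ?_ hr
  · intro z (hz : 0 < z.re)
    exact ((differentiableAt_id.cpow_const (Or.inl hz)).const_mul _).differentiableWithinAt
  · have lim : Tendsto ((↑) : ℝ → ℂ) (𝓝[≠] 1) (𝓝[≠] 1) := by
      refine tendsto_nhdsWithin_of_tendsto_nhds_of_eventually_within _ ?_ ?_
      · exact (Complex.continuous_ofReal.tendsto' 1 1 (by simp)).mono_left nhdsWithin_le_nhds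
      · filter_upwards [self_mem_nhdsWithin] with x hx
        simpa using hx
    refine lim.frequently (Eventually.frequently ?_)
    filter_upwards [nhdsWithin_le_nhds (lt_mem_nhds (zero_lt_one' ℝ))] with x hx
    exact integral_cpow_mul_exp_sub_one_of_pos h0 h1 hx

/-- The Cauchy–Saalschütz integral for the Gamma function, on the closed right half-plane. -/
theorem integral_cpow_mul_exp_sub_one {s : ℂ} (h0 : -1 < s.re) (h1 : s.re < 0) {r : ℂ}
    (hr : 0 ≤ r.re) :
    ∫ x in Ioi (0 : ℝ), (x : ℂ) ^ (s - 1) * (Complex.exp (-(r * x)) - 1)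
      = Complex.Gamma s * r ^ (-s) := by
  have hshift : Tendsto (fun ε : ℝ => r + ε) (𝓝[>] 0) (𝓝 r) :=
    ((by fun_prop : Continuous fun ε : ℝ => r + ε).tendsto' 0 r (by simp)).mono_left
      nhdsWithin_le_nhds
  have hint : Tendsto (fun ε : ℝ => ∫ x in Ioi (0 : ℝ),
        (x : ℂ) ^ (s - 1) * (Complex.exp (-((r + ε) * x)) - 1)) (𝓝[>] 0)
      (𝓝 (∫ x in Ioi (0 : ℝ), (x : ℂ) ^ (s - 1) * (Complex.exp (-(r * x)) - 1))) := by
    refine tendsto_integral_filter_of_dominated_convergence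
      (fun x => 2 * (x ^ (s.re - 1) * min 1 ((‖r‖ + 1) * x)))
      (Eventually.of_forall fun ε => aestronglyMeasurable_cpow_mul _ (by fun_prop)) ?_
      ((integrableOn_rpow_mul_min h0 h1 (by positivity)).const_mul 2) ?_
    · filter_upwards [self_mem_nhdsWithin, hshift.norm.eventually_le_const (lt_add_one ‖r‖)]
        with ε (hε : 0 < ε) hle
      filter_upwards [ae_restrict_mem measurableSet_Ioi] with x hx
      refine norm_cpow_mul_exp_sub_one_le ?_ hle hx
      rw [Complex.add_re, Complex.ofReal_re]
      positivity
    · refine Eventually.of_forall fun x => ?_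
      exact (((hshift.mul_const (x : ℂ)).neg.cexp).sub_const 1).const_mul _
  have hcpow : ContinuousAt (fun z : ℂ => z ^ (-s)) r :=
    Complex.continuousAt_cpow_const_of_re_pos (Or.inl hr) (by simpa using h1)
  refine tendsto_nhds_unique hint (((hcpow.tendsto.comp hshift).const_mul _).congr' ?_)
  filter_upwards [self_mem_nhdsWithin] with ε (hε : 0 < ε)
  refine (integral_cpow_mul_exp_sub_one_of_re_pos h0 h1 ?_).symm
  rw [Complex.add_re, Complex.ofReal_re]
  positivity

theorem cpow_mul_sin_eq (s : ℂ) (a x : ℝ) :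
    (x : ℂ) ^ s * (Real.sin (a * x) : ℂ)
      = ((x : ℂ) ^ s * (Complex.exp (-(a * -Complex.I * x)) - 1)
          - (x : ℂ) ^ s * (Complex.exp (-(a * Complex.I * x)) - 1)) * (-Complex.I / 2) := by
  rw [Complex.ofReal_sin, Complex.sin, Complex.ofReal_mul,
    show -((a : ℂ) * x) * Complex.I = -(a * Complex.I * x) by ring,
    show (a : ℂ) * x * Complex.I = -(a * -Complex.I * x) by ring]
  ring

/-- For `0 < Re w < 1` and `t > 0`, `∫₀^∞ u^{w-2}·sin(2πtu) du` converges absolutely and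
equals `(1/(1-w))·(2πt)^{1-w}·cos(πw/2)·Γ(w)`. -/
theorem integral_cpow_mul_sin (w : ℂ) (h0 : 0 < w.re) (h1 : w.re < 1)
    (t : ℝ) (ht : 0 < t) :
    MeasureTheory.IntegrableOn
        (fun u : ℝ => (u : ℂ) ^ (w - 2) * (Real.sin (2 * Real.pi * t * u) : ℂ))
        (Set.Ioi 0) ∧
      ∫ u in Set.Ioi (0:ℝ), (u : ℂ) ^ (w - 2) * (Real.sin (2 * Real.pi * t * u) : ℂ)
        = (1 / (1 - w)) * ((2 * Real.pi * t : ℝ) : ℂ) ^ (1 - w)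
            * Complex.cos ((Real.pi : ℂ) * w / 2) * Complex.Gamma w := by
  have hs0 : -1 < (w - 1).re := by simpa using h0
  have hs1 : (w - 1).re < 0 := by simpa using h1
  have hw : w - 1 ≠ 0 := fun h => by simp [h] at hs1
  have hw' : 1 - w ≠ 0 := fun h => hw (by linear_combination -h)
  set a : ℝ := 2 * Real.pi * t
  have ha : 0 < a := by positivity
  have hr₁ : 0 ≤ ((a : ℂ) * -Complex.I).re := by simp
  have hr₂ : 0 ≤ ((a : ℂ) * Complex.I).re := by simp
  have hi₁ := integrableOn_cpow_mul_exp_sub_one hs0 hs1 hr₁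
  have hi₂ := integrableOn_cpow_mul_exp_sub_one hs0 hs1 hr₂
  have hJ₁ := integral_cpow_mul_exp_sub_one hs0 hs1 hr₁
  have hJ₂ := integral_cpow_mul_exp_sub_one hs0 hs1 hr₂
  rw [sub_sub, one_add_one_eq_two] at hi₁ hi₂ hJ₁ hJ₂
  simp_rw [cpow_mul_sin_eq]
  refine ⟨(hi₁.sub hi₂).mul_const _, ?_⟩
  rw [integral_mul_const, integral_sub hi₁ hi₂, hJ₁, hJ₂, neg_sub]
  have hpow {z : ℂ} (hz : z ≠ 0) :
      ((a : ℂ) * z) ^ (1 - w) = (a : ℂ) ^ (1 - w) * z ^ (1 - w) := by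
    have haC : (a : ℂ) ≠ 0 := Complex.ofReal_ne_zero.mpr ha.ne'
    rw [Complex.cpow_def_of_ne_zero (mul_ne_zero haC hz), Complex.cpow_def_of_ne_zero haC,
      Complex.cpow_def_of_ne_zero hz, Complex.log_ofReal_mul ha hz, Complex.ofReal_log ha.le,
      add_mul, Complex.exp_add]
  have hI : Complex.I ^ (1 - w) = Complex.I * Complex.exp (-(Real.pi * w / 2 * Complex.I)) := by
    rw [Complex.cpow_def_of_ne_zero Complex.I_ne_zero, Complex.log_I, mul_sub, mul_one,
      sub_eq_add_neg, Complex.exp_add, Complex.exp_pi_div_two_mul_I]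
    ring_nf
  have hnegI : (-Complex.I) ^ (1 - w)
      = -Complex.I * Complex.exp (Real.pi * w / 2 * Complex.I) := by
    rw [Complex.cpow_def_of_ne_zero (neg_ne_zero.mpr Complex.I_ne_zero), Complex.log_neg_I, mul_sub,
      mul_one, sub_eq_add_neg, Complex.exp_add, ← neg_div, Complex.exp_neg_pi_div_two_mul_I]
    ring_nf
  have hGamma := Complex.Gamma_add_one (w - 1) hw
  rw [sub_add_cancel] at hGamma
  rw [hpow (neg_ne_zero.mpr Complex.I_ne_zero), hpow Complex.I_ne_zero, hI, hnegI, hGamma,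
    Complex.cos, neg_mul (Real.pi * w / 2 : ℂ)]
  field_simp
  ring_nf
  simp only [Complex.I_sq]
  ring
end
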